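/- arXiv:1709.00059 — 2 statements merged into one kernel-verified Lean document; each statement's English description precedes it below -/
import Mathlib

section
/- Let k > 1 be an integer. The Beloshapka–Coffman normal form 𝓜_k ⊆ ℂ^{3k-1} is locally polynomially convex at the origin O: there exists r₀ > 0 such that for every 0 < r ≤ r₀, the compact set 𝓜_k ∩ B̄_O(r) is polynomially convex, where B̄_O(r) is the closed Euclidean ball of radius r centered at the origin in ℂ^{3k-1}. -/
open scoped Manifold ComplexConjugate

noncomputable section

/-- Evaluation of a holomorphic polynomial on `ℂ^n`. -/
def evalPoly {n : ℕ} (P : MvPolynomial (Fin n) ℂ) (z : EuclideanSpace ℂ (Fin n)) : ℂ :=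
  MvPolynomial.eval (fun i => z i) P

/-- The polynomially convex hull of a set `K ⊆ ℂ^n`. -/
def polyHull {n : ℕ} (K : Set (EuclideanSpace ℂ (Fin n))) : Set (EuclideanSpace ℂ (Fin n)) :=
  {z | ∀ P : MvPolynomial (Fin n) ℂ, ‖evalPoly P z‖ ≤ ⨆ w ∈ K, ‖evalPoly P w‖}

/-- A set is polynomially convex if it coincides with its polynomially convex hull. -/
def IsPolyConvex {n : ℕ} (K : Set (EuclideanSpace ℂ (Fin n))) : Prop := polyHull K = K

/-- The rationally convex hull of a set `K ⊆ ℂ^n`. -/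
def ratHull {n : ℕ} (K : Set (EuclideanSpace ℂ (Fin n))) : Set (EuclideanSpace ℂ (Fin n)) :=
  {z | ∀ P : MvPolynomial (Fin n) ℂ, evalPoly P z = 0 → ∃ w ∈ K, evalPoly P w = 0}

/-- The closed half-space `{x ∈ ℝ^d : x₀ ≥ 0}`. -/
def halfSpace (d : ℕ) (hd : 0 < d) : Set (EuclideanSpace ℝ (Fin d)) :=
  {x | 0 ≤ x ⟨0, hd⟩}

/-- `M ⊆ ℂ^n` is a `d`-dimensional smooth compact submanifold (possibly with boundary):
every point admits a smooth local parametrization by a relatively open subset of the closed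
half-space `H ⊆ ℝ^d`, which is an immersion and a homeomorphism onto a relatively open
subset of `M`. (Charts with image in the open half-space cover interior points, so closed
submanifolds are included.) -/
def IsSubmanifold {n : ℕ} (d : ℕ) (hd : 0 < d) (M : Set (EuclideanSpace ℂ (Fin n))) : Prop :=
  ∀ p ∈ M, ∃ (V : Set (EuclideanSpace ℝ (Fin d))) (U : Set (EuclideanSpace ℂ (Fin n)))
    (f : EuclideanSpace ℝ (Fin d) → EuclideanSpace ℂ (Fin n)),
    IsOpen V ∧ IsOpen U ∧ p ∈ U ∧ ContDiffOn ℝ (⊤ : ℕ∞) f V ∧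
    Set.InjOn f (V ∩ halfSpace d hd) ∧
    (∀ x ∈ V, Function.Injective (fderiv ℝ f x)) ∧
    f '' (V ∩ halfSpace d hd) = M ∩ U ∧
    (∀ W, IsOpen W → W ⊆ V → ∃ U', IsOpen U' ∧ f '' (W ∩ halfSpace d hd) = M ∩ U')

/-- `p` is a boundary point of the submanifold `M`: some local parametrization as above
maps a point on the boundary of the half-space to `p`. -/
def IsBoundaryPoint {n : ℕ} (d : ℕ) (hd : 0 < d) (M : Set (EuclideanSpace ℂ (Fin n)))
    (p : EuclideanSpace ℂ (Fin n)) : Prop :=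
  p ∈ M ∧ ∃ (V : Set (EuclideanSpace ℝ (Fin d))) (U : Set (EuclideanSpace ℂ (Fin n)))
    (f : EuclideanSpace ℝ (Fin d) → EuclideanSpace ℂ (Fin n)),
    IsOpen V ∧ IsOpen U ∧ p ∈ U ∧ ContDiffOn ℝ (⊤ : ℕ∞) f V ∧
    Set.InjOn f (V ∩ halfSpace d hd) ∧
    (∀ x ∈ V, Function.Injective (fderiv ℝ f x)) ∧
    f '' (V ∩ halfSpace d hd) = M ∩ U ∧
    (∀ W, IsOpen W → W ⊆ V → ∃ U', IsOpen U' ∧ f '' (W ∩ halfSpace d hd) = M ∩ U') ∧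
    ∃ x ∈ V ∩ halfSpace d hd, f x = p ∧ x ⟨0, hd⟩ = 0

/-- The tangent space of `M ⊆ ℂ^n` at `p`, as a real subspace of `ℂ^n`. -/
def tangentSpaceAt {n : ℕ} (M : Set (EuclideanSpace ℂ (Fin n)))
    (p : EuclideanSpace ℂ (Fin n)) : Submodule ℝ (EuclideanSpace ℂ (Fin n)) :=
  Submodule.span ℝ (tangentConeAt ℝ M p)

/-- `M` is totally real at `p`: `T_pM ∩ i·T_pM = {0}`. -/
def TotallyRealAt {n : ℕ} (M : Set (EuclideanSpace ℂ (Fin n)))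
    (p : EuclideanSpace ℂ (Fin n)) : Prop :=
  ∀ v ∈ tangentSpaceAt M p, Complex.I • v ∈ tangentSpaceAt M p → v = (0 : EuclideanSpace ℂ (Fin n))

/-- The Beloshapka–Coffman normal form `𝓜_k ⊆ ℂ^{3k-1}`, in coordinates
`Z = (z, w₁, …, w_{2k-2}, ζ₁, …, ζ_k)`, `w_τ = u_τ + i v_τ`. -/
def bcForm (k : ℕ) (hk : 1 < k) : Set (EuclideanSpace ℂ (Fin (3*k-1))) :=
  {Z | (∀ τ : ℕ, ∀ _h1 : 1 ≤ τ, ∀ _h2 : τ ≤ 2*k-2, (Z ⟨τ, by omega⟩).im = 0) ∧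
    Z ⟨2*k-1, by omega⟩ = (Complex.normSq (Z ⟨0, by omega⟩) : ℂ) +
      conj (Z ⟨0, by omega⟩) * (((Z ⟨1, by omega⟩).re : ℂ) + Complex.I * ((Z ⟨2, by omega⟩).re : ℂ)) ∧
    (∀ σ : ℕ, ∀ _h1 : 2 ≤ σ, ∀ _h2 : σ ≤ k-1,
      Z ⟨2*k-2+σ, by omega⟩ = conj (Z ⟨0, by omega⟩) *
        (((Z ⟨2*σ-1, by omega⟩).re : ℂ) + Complex.I * ((Z ⟨2*σ, by omega⟩).re : ℂ))) ∧
    Z ⟨3*k-2, by omega⟩ = (conj (Z ⟨0, by omega⟩))^2}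

/-- `p` is a generic CR-singularity of `M ⊆ ℂ^{3k-1}`: `(M, p)` is locally biholomorphic
to `(𝓜_k, O)`. -/
def IsGenericCRSingularity (k : ℕ) (hk : 1 < k) (M : Set (EuclideanSpace ℂ (Fin (3*k-1))))
    (p : EuclideanSpace ℂ (Fin (3*k-1))) : Prop :=
  ∃ (U V : Set (EuclideanSpace ℂ (Fin (3*k-1))))
    (Φ Ψ : EuclideanSpace ℂ (Fin (3*k-1)) → EuclideanSpace ℂ (Fin (3*k-1))),
    IsOpen U ∧ IsOpen V ∧ p ∈ U ∧ (0 : EuclideanSpace ℂ (Fin (3*k-1))) ∈ V ∧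
    DifferentiableOn ℂ Φ U ∧ DifferentiableOn ℂ Ψ V ∧
    Set.MapsTo Φ U V ∧ Set.MapsTo Ψ V U ∧
    (∀ x ∈ U, Ψ (Φ x) = x) ∧ (∀ y ∈ V, Φ (Ψ y) = y) ∧
    Φ p = 0 ∧ Φ '' (M ∩ U) = bcForm k hk ∩ V

/-- The Laplacian at `0` of the slice function `λ ↦ ρ(p + λ·v)`. -/
def sliceLaplacian {n : ℕ} (ρ : EuclideanSpace ℂ (Fin n) → ℝ)
    (p v : EuclideanSpace ℂ (Fin n)) : ℝ :=
  iteratedFDeriv ℝ 2 (fun lam : ℂ => ρ (p + lam • v)) 0 ![1, 1]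
  + iteratedFDeriv ℝ 2 (fun lam : ℂ => ρ (p + lam • v)) 0 ![Complex.I, Complex.I]

/-- `ρ` is plurisubharmonic on `U`. -/
def PshOn {n : ℕ} (ρ : EuclideanSpace ℂ (Fin n) → ℝ) (U : Set (EuclideanSpace ℂ (Fin n))) : Prop :=
  ∀ p ∈ U, ∀ v : EuclideanSpace ℂ (Fin n), 0 ≤ sliceLaplacian ρ p v

/-- `ρ` is strictly plurisubharmonic at `p`. -/
def StrictPshAt {n : ℕ} (ρ : EuclideanSpace ℂ (Fin n) → ℝ)
    (p : EuclideanSpace ℂ (Fin n)) : Prop :=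
  ∀ v : EuclideanSpace ℂ (Fin n), v ≠ 0 → 0 < sliceLaplacian ρ p v

/-- `ρ` is strictly plurisubharmonic on a set. -/
def StrictPshOn {n : ℕ} (ρ : EuclideanSpace ℂ (Fin n) → ℝ)
    (U : Set (EuclideanSpace ℂ (Fin n))) : Prop :=
  ∀ p ∈ U, StrictPshAt ρ p

section PolyHull

variable {n : ℕ} {K : Set (EuclideanSpace ℂ (Fin n))} {z : EuclideanSpace ℂ (Fin n)}

theorem continuous_evalPoly (P : MvPolynomial (Fin n) ℂ) : Continuous (evalPoly P) := by
  unfold evalPoly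
  exact P.continuous_eval.comp (by fun_prop)

/-- A bound for `‖P‖` on `K` persists on the polynomially convex hull of `K`. -/
theorem norm_evalPoly_le_of_mem_polyHull (hz : z ∈ polyHull K) (P : MvPolynomial (Fin n) ℂ) {c : ℝ}
    (hc : 0 ≤ c) (h : ∀ w ∈ K, ‖evalPoly P w‖ ≤ c) : ‖evalPoly P z‖ ≤ c :=
  (hz P).trans <| Real.iSup_le (fun w => Real.iSup_le (fun hw => h w hw) hc) hc

theorem nonempty_of_mem_polyHull (hz : z ∈ polyHull K) : K.Nonempty := by
  rw [Set.nonempty_iff_ne_empty]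
  rintro rfl
  have := norm_evalPoly_le_of_mem_polyHull hz 1 le_rfl (by simp)
  norm_num [evalPoly] at this

theorem subset_polyHull (hK : IsCompact K) : K ⊆ polyHull K := by
  intro z hz P
  obtain ⟨C, hC⟩ := hK.exists_bound_of_continuousOn (continuous_evalPoly P).continuousOn
  have hC0 : 0 ≤ C := (norm_nonneg _).trans (hC z hz)
  have hb : BddAbove (Set.range fun w => ⨆ _ : w ∈ K, ‖evalPoly P w‖) := by
    refine ⟨C, ?_⟩
    rintro _ ⟨w, rfl⟩
    exact Real.iSup_le (fun hw => hC w hw) hC0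
  refine le_trans ?_ (le_ciSup hb z)
  rw [ciSup_pos hz]

theorem polyHull_mono (hK : IsCompact K) {L : Set (EuclideanSpace ℂ (Fin n))} (h : L ⊆ K) :
    polyHull L ⊆ polyHull K := by
  intro z hz P
  refine norm_evalPoly_le_of_mem_polyHull hz P ?_ fun w hw => subset_polyHull hK (h hw) P
  exact Real.iSup_nonneg fun w => Real.iSup_nonneg fun _ => norm_nonneg _

/-- Closed balls centred at the origin are polynomially convex. -/
theorem polyHull_closedBall_subset (r : ℝ) :
    polyHull (Metric.closedBall (0 : EuclideanSpace ℂ (Fin n)) r) ⊆ Metric.closedBall 0 r := by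
  intro z hz
  have hr : 0 ≤ r := Metric.nonempty_closedBall.1 (nonempty_of_mem_polyHull hz)
  have hQ : ∀ w, evalPoly (∑ i, MvPolynomial.C (starRingEnd ℂ (z i)) * MvPolynomial.X i) w
      = inner ℂ z w := by
    intro w
    simp [evalPoly, PiLp.inner_apply, mul_comm]
  have h := norm_evalPoly_le_of_mem_polyHull hz
    (∑ i, MvPolynomial.C (starRingEnd ℂ (z i)) * MvPolynomial.X i) (c := ‖z‖ * r) (by positivity)
    (by
      intro w hw
      rw [hQ]
      exact (norm_inner_le_norm z w).trans (by gcongr; simpa using hw))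
  rw [hQ, inner_self_eq_norm_sq_to_K] at h
  simp only [norm_pow, Complex.coe_algebraMap, Complex.norm_real, norm_norm] at h
  rw [mem_closedBall_zero_iff]
  by_contra hlt
  nlinarith [norm_nonneg z]

/-- If the polynomials in `S` are real on `K`, then a bound for `‖Q‖` on the common level set of
`S` in `K` determined by the real parts at a point `z` of the hull persists at `z`. -/
theorem norm_evalPoly_le_of_level_re (hK : IsCompact K) (hz : z ∈ polyHull K)
    (S : Finset (MvPolynomial (Fin n) ℂ)) (hS : ∀ P ∈ S, ∀ w ∈ K, (evalPoly P w).im = 0)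
    (Q : MvPolynomial (Fin n) ℂ) {c : ℝ} (hc : 0 ≤ c)
    (hQ : ∀ w ∈ K, (∀ P ∈ S, evalPoly P w = (evalPoly P z).re) → ‖evalPoly Q w‖ ≤ c) :
    ‖evalPoly Q z‖ ≤ c := by
  let d : EuclideanSpace ℂ (Fin n) → ℝ :=
    fun w => ∑ P ∈ S, ((evalPoly P w).re - (evalPoly P z).re) ^ 2
  have hd0 : ∀ w, 0 ≤ d w := fun w => Finset.sum_nonneg fun P _ => sq_nonneg _
  have hdc : Continuous d := by
    refine continuous_finsetSum _ fun P _ => ?_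
    have := Complex.continuous_re.comp (continuous_evalPoly P)
    exact (this.sub continuous_const).pow 2
  obtain ⟨L', hL'⟩ := hK.exists_bound_of_continuousOn hdc.continuousOn
  obtain ⟨C', hC'⟩ := hK.exists_bound_of_continuousOn (continuous_evalPoly Q).continuousOn
  set L := max L' 1 with hLdef
  set C := max C' 0 with hCdef
  have hL : ∀ w ∈ K, d w ≤ L := fun w hw =>
    (le_abs_self _).trans ((hL' w hw).trans (le_max_left _ _))
  have hLpos : 0 < L := lt_of_lt_of_le one_pos (le_max_right _ _)
  have hC : ∀ w ∈ K, ‖evalPoly Q w‖ ≤ C := fun w hw => (hC' w hw).trans (le_max_left _ _)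
  have hC0 : 0 ≤ C := le_max_right _ _
  let H : MvPolynomial (Fin n) ℂ :=
    MvPolynomial.C (L : ℂ) - ∑ P ∈ S, (P - MvPolynomial.C (((evalPoly P z).re : ℝ) : ℂ)) ^ 2
  have hHe : ∀ w, evalPoly H w = L - ∑ P ∈ S, (evalPoly P w - ((evalPoly P z).re : ℝ)) ^ 2 := by
    intro w
    simp [H, evalPoly, map_sum]
  have hHK : ∀ w ∈ K, ‖evalPoly H w‖ = L - d w := by
    intro w hw
    have : evalPoly H w = ((L - d w : ℝ) : ℂ) := by
      rw [hHe]
      simp only [d]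
      push_cast
      congr 1
      refine Finset.sum_congr rfl fun P hP => ?_
      congr 2
      exact Complex.ext (by simp) (by simpa using hS P hP w hw)
    rw [this, Complex.norm_real, Real.norm_of_nonneg (sub_nonneg.2 (hL w hw))]
  have hHz : L ≤ ‖evalPoly H z‖ := by
    have : evalPoly H z = ((L + ∑ P ∈ S, (evalPoly P z).im ^ 2 : ℝ) : ℂ) := by
      rw [hHe]
      push_cast
      rw [sub_eq_add_neg, ← Finset.sum_neg_distrib]
      congr 1
      refine Finset.sum_congr rfl fun P hP => ?_
      have : evalPoly P z - ((evalPoly P z).re : ℝ) = (evalPoly P z).im * Complex.I :=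
        Complex.ext (by simp) (by simp)
      rw [this, mul_pow, Complex.I_sq]
      ring
    have hs : 0 ≤ ∑ P ∈ S, (evalPoly P z).im ^ 2 := Finset.sum_nonneg fun P _ => sq_nonneg _
    rw [this, Complex.norm_real, Real.norm_of_nonneg (by positivity)]
    linarith
  refine le_of_forall_gt_imp_ge_of_dense fun c' hc' => ?_
  have hc'0 : 0 < c' := hc.trans_lt hc'
  have hT : IsCompact (K ∩ {w | c' ≤ ‖evalPoly Q w‖}) :=
    hK.inter_right (isClosed_le continuous_const (continuous_evalPoly Q).norm)
  obtain ⟨δ, hδ, hδL, hδT⟩ : ∃ δ : ℝ, 0 < δ ∧ δ ≤ L ∧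
      ∀ w ∈ K, c' ≤ ‖evalPoly Q w‖ → δ ≤ d w := by
    rcases (K ∩ {w | c' ≤ ‖evalPoly Q w‖}).eq_empty_or_nonempty with he | hne
    · refine ⟨L, hLpos, le_rfl, fun w hw hw' => ?_⟩
      have : w ∈ K ∩ {w | c' ≤ ‖evalPoly Q w‖} := ⟨hw, hw'⟩
      simp [he] at this
    · obtain ⟨w₀, ⟨hw₀, hw₀'⟩, hmin⟩ := hT.exists_isMinOn hne hdc.continuousOn
      refine ⟨d w₀, lt_of_le_of_ne (hd0 _) fun h0 => ?_, hL _ hw₀, fun w hw hw' => hmin ⟨hw, hw'⟩⟩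
      refine absurd (hQ w₀ hw₀ fun P hP => ?_) (not_le.2 (hc'.trans_le hw₀'))
      have := (Finset.sum_eq_zero_iff_of_nonneg fun P _ => sq_nonneg _).1 h0.symm P hP
      have := sub_eq_zero.1 (pow_eq_zero_iff two_ne_zero |>.1 this)
      exact Complex.ext (by simpa using this) (by simpa using hS P hP w₀ hw₀)
  have hlim : Filter.Tendsto (fun m : ℕ => C * ((L - δ) / L) ^ m) Filter.atTop (nhds 0) := by
    have := tendsto_pow_atTop_nhds_zero_of_lt_one (r := (L - δ) / L)
      (div_nonneg (by linarith) hLpos.le) ((div_lt_one hLpos).2 (by linarith))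
    simpa using this.const_mul C
  obtain ⟨m, hm⟩ := (hlim.eventually (gt_mem_nhds hc'0)).exists
  have hmul : ∀ w, ‖evalPoly (Q * H ^ m) w‖ = ‖evalPoly Q w‖ * ‖evalPoly H w‖ ^ m := by
    intro w
    simp [evalPoly]
  have key := norm_evalPoly_le_of_mem_polyHull hz (Q * H ^ m) (c := c' * L ^ m) (by positivity) (by
    intro w hw
    rw [hmul, hHK w hw]
    have h0 : 0 ≤ L - d w := sub_nonneg.2 (hL w hw)
    rcases le_total c' ‖evalPoly Q w‖ with h | h
    · have h1 : C * (L - δ) ^ m ≤ c' * L ^ m := by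
        rw [div_pow, ← mul_div_assoc, div_lt_iff₀ (by positivity)] at hm
        exact hm.le
      refine le_trans ?_ h1
      gcongr
      · exact hC w hw
      · exact hδT w hw h
    · gcongr
      linarith [hd0 w])
  rw [hmul] at key
  have : ‖evalPoly Q z‖ * L ^ m ≤ c' * L ^ m := le_trans (by gcongr) key
  exact le_of_mul_le_mul_right this (by positivity)

/-- If the polynomials in `S` are real on `K` and `z` lies in the hull of `K`, then they take real
values at `z`. -/
theorem evalPoly_eq_re_of_mem_polyHull (hK : IsCompact K) (hz : z ∈ polyHull K)
    (S : Finset (MvPolynomial (Fin n) ℂ)) (hS : ∀ P ∈ S, ∀ w ∈ K, (evalPoly P w).im = 0)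
    {P : MvPolynomial (Fin n) ℂ} (hP : P ∈ S) : evalPoly P z = (evalPoly P z).re := by
  have hev : ∀ w, evalPoly (P - MvPolynomial.C (((evalPoly P z).re : ℝ) : ℂ)) w
      = evalPoly P w - ((evalPoly P z).re : ℝ) := by
    intro w
    simp [evalPoly]
  have h := norm_evalPoly_le_of_level_re hK hz S hS
    (P - MvPolynomial.C (((evalPoly P z).re : ℝ) : ℂ)) le_rfl (by
      intro w hw hw'
      rw [hev, hw' P hP]
      simp)
  rw [hev] at h
  exact sub_eq_zero.1 (norm_le_zero_iff.1 h)

/-- If the polynomials in `S` are real on `K`, then every point of the hull of `K` lies in the hull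
of its own level set of `S` in `K`. -/
theorem mem_polyHull_level (hK : IsCompact K) (hz : z ∈ polyHull K)
    (S : Finset (MvPolynomial (Fin n) ℂ)) (hS : ∀ P ∈ S, ∀ w ∈ K, (evalPoly P w).im = 0) :
    z ∈ polyHull {w ∈ K | ∀ P ∈ S, evalPoly P w = evalPoly P z} := by
  intro Q
  have hcl : IsClosed {w : EuclideanSpace ℂ (Fin n) | ∀ P ∈ S, evalPoly P w = evalPoly P z} := by
    simp only [Set.ofPred_forall]
    exact isClosed_biInter fun P _ => isClosed_eq (continuous_evalPoly P) continuous_const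
  refine norm_evalPoly_le_of_level_re hK hz S hS Q
    (Real.iSup_nonneg fun w => Real.iSup_nonneg fun _ => norm_nonneg _) fun w hw hw' => ?_
  exact subset_polyHull (hK.inter_right hcl) ⟨hw, fun P hP => by
    rw [hw' P hP, ← evalPoly_eq_re_of_mem_polyHull hK hz S hS hP]⟩ Q

/-- Polynomials agreeing on `K` agree on the hull of `K`. -/
theorem evalPoly_eq_of_mem_polyHull (hz : z ∈ polyHull K) (P Q : MvPolynomial (Fin n) ℂ)
    (h : ∀ w ∈ K, evalPoly P w = evalPoly Q w) : evalPoly P z = evalPoly Q z := by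
  have hev : ∀ w, evalPoly (P - Q) w = evalPoly P w - evalPoly Q w := fun w => by simp [evalPoly]
  have := norm_evalPoly_le_of_mem_polyHull hz (P - Q) le_rfl (by
    intro w hw
    simp [hev, h w hw])
  rw [hev] at this
  exact sub_eq_zero.1 (norm_le_zero_iff.1 this)

/-- On a set where `|zᵢ|² = t` is constant and `z_j = conj(zᵢ)²`, the function `conj(zᵢ)` is given by
a polynomial, and this representation persists on the hull. -/
theorem exists_evalPoly_eq_conj (hz : z ∈ polyHull K) {i j : Fin n} {t : ℝ}
    (ht : ∀ w ∈ K, Complex.normSq (w i) = t) (hj : ∀ w ∈ K, w j = conj (w i) ^ 2) :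
    ∃ G : MvPolynomial (Fin n) ℂ,
      (∀ w ∈ K, evalPoly G w = conj (w i)) ∧ evalPoly G z = conj (z i) := by
  have hX : ∀ w, evalPoly (MvPolynomial.X i) w = w i := fun w => by simp [evalPoly]
  rcases eq_or_ne t 0 with rfl | ht0
  · have hw : ∀ w ∈ K, w i = 0 := fun w hw => Complex.normSq_eq_zero.1 (ht w hw)
    have hzi : z i = 0 := by
      have := evalPoly_eq_of_mem_polyHull hz (MvPolynomial.X i) 0 fun w hwK => by
        simp [evalPoly, hw w hwK]
      simpa [evalPoly] using this
    exact ⟨0, fun w hwK => by simp [evalPoly, hw w hwK], by simp [evalPoly, hzi]⟩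
  let G : MvPolynomial (Fin n) ℂ :=
    MvPolynomial.C ((t : ℂ)⁻¹) * (MvPolynomial.X i * MvPolynomial.X j)
  have hGK : ∀ w ∈ K, evalPoly G w = conj (w i) := by
    intro w hw
    have h1 : w i * conj (w i) = t := by rw [Complex.mul_conj, ht w hw]
    have h2 : (t : ℂ) ≠ 0 := by exact_mod_cast ht0
    have h3 : evalPoly G w = (t : ℂ)⁻¹ * (w i * w j) := by simp [G, evalPoly]
    rw [h3, hj w hw, pow_two, ← mul_assoc (w i), h1, inv_mul_cancel_left₀ h2]
  have hnorm : ∀ w ∈ K, ‖w i‖ ≤ √t := by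
    intro w hw
    rw [← ht w hw, Complex.normSq_eq_norm_sq, Real.sqrt_sq (norm_nonneg _)]
  obtain ⟨w₀, hw₀⟩ := nonempty_of_mem_polyHull hz
  have htn : 0 ≤ t := ht w₀ hw₀ ▸ Complex.normSq_nonneg _
  have h1 : ‖z i‖ ≤ √t := by
    have := norm_evalPoly_le_of_mem_polyHull hz (MvPolynomial.X i) (Real.sqrt_nonneg t)
      fun w hw => by rw [hX]; exact hnorm w hw
    rwa [hX] at this
  have h2 : ‖evalPoly G z‖ ≤ √t :=
    norm_evalPoly_le_of_mem_polyHull hz G (Real.sqrt_nonneg t) fun w hw => by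
      rw [hGK w hw, RCLike.norm_conj]; exact hnorm w hw
  have hXG : ∀ w, evalPoly (MvPolynomial.X i * G) w = w i * evalPoly G w := fun w => by
    simp [evalPoly]
  have h3 : z i * evalPoly G z = t := by
    have := evalPoly_eq_of_mem_polyHull hz (MvPolynomial.X i * G) (MvPolynomial.C (t : ℂ))
      fun w hw => by
        rw [hXG, hGK w hw, Complex.mul_conj, ht w hw]; simp [evalPoly]
    rw [hXG] at this
    simpa [evalPoly] using this
  refine ⟨G, hGK, sub_eq_zero.1 (Complex.normSq_eq_zero.1 (le_antisymm ?_ (Complex.normSq_nonneg _)))⟩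
  rw [Complex.normSq_sub, Complex.conj_conj, Complex.normSq_conj, mul_comm (evalPoly G z), h3,
    Complex.normSq_eq_norm_sq, Complex.normSq_eq_norm_sq, Complex.ofReal_re]
  have h1' := pow_le_pow_left₀ (norm_nonneg _) h1 2
  have h2' := pow_le_pow_left₀ (norm_nonneg _) h2 2
  rw [Real.sq_sqrt htn] at h1' h2'
  linarith

end PolyHull

theorem isClosed_bcForm (k : ℕ) (hk : 1 < k) : IsClosed (bcForm k hk) := by
  unfold bcForm
  simp only [Set.ofPred_and, Set.ofPred_forall]
  refine IsClosed.inter ?_ (IsClosed.inter ?_ (IsClosed.inter ?_ ?_))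
  · refine isClosed_iInter fun τ => isClosed_iInter fun _ => isClosed_iInter fun _ => ?_
    exact isClosed_eq (by fun_prop) (by fun_prop)
  · refine isClosed_eq (by fun_prop) ?_
    have := Complex.continuous_normSq
    fun_prop
  · refine isClosed_iInter fun τ => isClosed_iInter fun _ => isClosed_iInter fun _ => ?_
    exact isClosed_eq (by fun_prop) (by fun_prop)
  · exact isClosed_eq (by fun_prop) (by fun_prop)

/-- **Lemma 3.1.** The Beloshapka–Coffman normal form `𝓜_k ⊆ ℂ^{3k-1}` (`k > 1`) is
locally polynomially convex at the origin: for all small enough `r > 0`, the set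
`𝓜_k ∩ B̄_O(r)` is polynomially convex. -/
theorem bcForm_locally_polynomially_convex
    (k : ℕ) (hk : 1 < k) :
    ∃ r₀ : ℝ, 0 < r₀ ∧ ∀ r : ℝ, 0 < r → r ≤ r₀ →
      IsPolyConvex (bcForm k hk ∩
        Metric.closedBall (0 : EuclideanSpace ℂ (Fin (3*k-1))) r) := by
  refine ⟨1, one_pos, fun r _ _ => ?_⟩
  set K := bcForm k hk ∩ Metric.closedBall (0 : EuclideanSpace ℂ (Fin (3*k-1))) r with hKdef
  have hK : IsCompact K := (isCompact_closedBall _ _).inter_left (isClosed_bcForm k hk)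
  refine Set.Subset.antisymm (fun Z hZ => ?_) (subset_polyHull hK)
  refine ⟨?_, polyHull_closedBall_subset r
    (polyHull_mono (isCompact_closedBall _ _) Set.inter_subset_right hZ)⟩
  let i₀ : Fin (3*k-1) := ⟨0, by omega⟩
  let j : Fin (3*k-1) := ⟨3*k-2, by omega⟩
  let S : Finset (MvPolynomial (Fin (3*k-1)) ℂ) := by
    classical
    exact insert (MvPolynomial.X i₀ ^ 2 * MvPolynomial.X j)
      ((Finset.univ.filter fun i : Fin (3*k-1) => 1 ≤ i.1 ∧ i.1 ≤ 2*k-2).image MvPolynomial.X)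
  have hmod : ∀ w ∈ K, evalPoly (MvPolynomial.X i₀ ^ 2 * MvPolynomial.X j) w
      = ((Complex.normSq (w i₀) ^ 2 : ℝ) : ℂ) := by
    intro w hw
    have h1 : w j = conj (w i₀) ^ 2 := hw.1.2.2.2
    have h2 : evalPoly (MvPolynomial.X i₀ ^ 2 * MvPolynomial.X j) w = w i₀ ^ 2 * w j := by
      simp [evalPoly]
    rw [h2, h1, ← mul_pow, Complex.mul_conj]
    push_cast
    rfl
  have hS : ∀ P ∈ S, ∀ w ∈ K, (evalPoly P w).im = 0 := by
    intro P hP w hw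
    simp only [S, Finset.mem_insert, Finset.mem_image, Finset.mem_filter, Finset.mem_univ,
      true_and] at hP
    rcases hP with rfl | ⟨i, hi, rfl⟩
    · rw [hmod w hw, Complex.ofReal_im]
    · simpa [evalPoly] using hw.1.1 i.1 hi.1 hi.2
  have hL := mem_polyHull_level hK hZ S hS
  set L := {w ∈ K | ∀ P ∈ S, evalPoly P w = evalPoly P Z} with hLdef
  obtain ⟨w₀, hw₀⟩ := nonempty_of_mem_polyHull hL
  have hreal : ∀ w ∈ L, ∀ i : Fin (3*k-1), 1 ≤ i.1 → i.1 ≤ 2*k-2 → w i = Z i := by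
    intro w hw i h1 h2
    have : MvPolynomial.X i ∈ S :=
      Finset.mem_insert_of_mem (Finset.mem_image_of_mem _ (by simp [h1, h2]))
    simpa [evalPoly] using hw.2 _ this
  have hcirc : ∀ w ∈ L, Complex.normSq (w i₀) = Complex.normSq (w₀ i₀) := by
    intro w hw
    have h := (hw.2 _ (Finset.mem_insert_self _ _)).trans
      (hw₀.2 _ (Finset.mem_insert_self _ _)).symm
    rw [hmod w hw.1, hmod w₀ hw₀.1, Complex.ofReal_inj] at h
    exact (pow_left_inj₀ (Complex.normSq_nonneg _) (Complex.normSq_nonneg _) two_ne_zero).1 h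
  obtain ⟨G, hG, hGZ⟩ := exists_evalPoly_eq_conj (i := i₀) (j := j) hL hcirc
    fun w hw => hw.1.1.2.2.2
  have him : ∀ τ : ℕ, ∀ _ : 1 ≤ τ, ∀ _ : τ ≤ 2*k-2, (Z ⟨τ, by omega⟩).im = 0 := by
    intro τ h1 h2
    rw [← hreal w₀ hw₀ ⟨τ, by omega⟩ h1 h2]
    exact hw₀.1.1.1 τ h1 h2
  have hre : ∀ W : EuclideanSpace ℂ (Fin (3*k-1)), ∀ i, (W i).im = 0 → ((W i).re : ℂ) = W i :=
    fun W i h => Complex.ext (by simp) (by simp [h])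
  refine ⟨him, ?_, ?_, ?_⟩
  · have b₁ : 1 < 3*k-1 := by omega
    have b₂ : 2 < 3*k-1 := by omega
    have h := evalPoly_eq_of_mem_polyHull hL (MvPolynomial.X ⟨2*k-1, by omega⟩)
      (MvPolynomial.X i₀ * G + G * (MvPolynomial.X ⟨1, b₁⟩ +
        MvPolynomial.C Complex.I * MvPolynomial.X ⟨2, b₂⟩)) (by
      intro w hw
      have e := hw.1.1.2.1
      rw [hre w _ (hw.1.1.1 1 le_rfl (by omega)), hre w _ (hw.1.1.1 2 (by omega) (by omega)),
        ← Complex.mul_conj, ← hG w hw] at e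
      simpa [evalPoly] using e)
    rw [hre Z _ (him 1 le_rfl (by omega)), hre Z _ (him 2 (by omega) (by omega)),
      ← Complex.mul_conj, ← hGZ]
    simpa [evalPoly] using h
  · intro σ h1 h2
    have b₁ : 2*σ-1 < 3*k-1 := by omega
    have b₂ : 2*σ < 3*k-1 := by omega
    have h := evalPoly_eq_of_mem_polyHull hL (MvPolynomial.X ⟨2*k-2+σ, by omega⟩)
      (G * (MvPolynomial.X ⟨2*σ-1, b₁⟩ +
        MvPolynomial.C Complex.I * MvPolynomial.X ⟨2*σ, b₂⟩)) (by
      intro w hw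
      have e := hw.1.1.2.2.1 σ h1 h2
      rw [hre w _ (hw.1.1.1 (2*σ-1) (by omega) (by omega)),
        hre w _ (hw.1.1.1 (2*σ) (by omega) (by omega)), ← hG w hw] at e
      simpa [evalPoly] using e)
    rw [hre Z _ (him (2*σ-1) (by omega) (by omega)), hre Z _ (him (2*σ) (by omega) (by omega)),
      ← hGZ]
    simpa [evalPoly] using h
  · have h := evalPoly_eq_of_mem_polyHull hL (MvPolynomial.X j) (G ^ 2) (by
      intro w hw
      have e : w j = conj (w i₀) ^ 2 := hw.1.1.2.2.2
      rw [← hG w hw] at e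
      simpa [evalPoly] using e)
    rw [← hGZ]
    simpa [evalPoly] using h
end
end

section
/- Let k > 1 be an integer. There exists r₀ > 0 such that for every 0 < r ≤ r₀ there is a smooth function ψ : ℂ^{3k-1} → ℝ, plurisubharmonic on ℂ^{3k-1}, satisfying: (a) {ψ = 0} = 𝓜_k ∩ B̄_O(r); (b) ψ > 0 on ℂ^{3k-1} \ (𝓜_k ∩ B̄_O(r)); and (c) ψ is strictly plurisubharmonic at every point of ℂ^{3k-1} \ {O}, where O is the origin and B̄_O(r) is the closed Euclidean ball of radius r centered at O in ℂ^{3k-1}. -/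
open scoped Manifold ComplexConjugate

noncomputable section

/-- The second order data of `f : ℂ → ℂ` at `0`: its value `a`, its Wirtinger derivatives
`p = ∂f/∂λ` and `q = ∂f/∂λ̄`, and the mixed second derivative `c = ∂²f/∂λ∂λ̄`. -/
structure HasJet (f : ℂ → ℂ) (a p q c : ℂ) : Prop where
  contDiff : ContDiff ℝ 2 f
  apply_zero : f 0 = a
  fderiv_apply : ∀ h : ℂ, fderiv ℝ f 0 h = p * h + q * conj h
  laplacian_apply : Laplacian.laplacian f 0 = 4 * c

namespace HasJet

variable {f g : ℂ → ℂ} {a p q c a' p' q' c' : ℂ}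

theorem congr (hf : HasJet f a p q c) (ha : a = a') (hp : p = p') (hq : q = q') (hc : c = c') :
    HasJet f a' p' q' c' := by
  subst ha hp hq hc
  exact hf

theorem affine (a p : ℂ) : HasJet (fun l => a + l * p) a p 0 0 := by
  have hd : fderiv ℝ (fun l : ℂ => a + l * p) =
      fun _ => (ContinuousLinearMap.mul ℝ ℂ).flip p := by
    ext1 x
    have h : HasFDerivAt (fun l : ℂ => a + l * p) ((ContinuousLinearMap.mul ℝ ℂ).flip p) x :=
      ((ContinuousLinearMap.mul ℝ ℂ).flip p).hasFDerivAt.const_add a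
    exact h.fderiv
  refine ⟨by fun_prop, by simp, fun h => ?_, ?_⟩
  · rw [hd]
    simp
  · simp [InnerProductSpace.laplacian_eq_iteratedFDeriv_complexPlane, iteratedFDeriv_two_apply, hd]

theorem add (hf : HasJet f a p q c) (hg : HasJet g a' p' q' c') :
    HasJet (fun l => f l + g l) (a + a') (p + p') (q + q') (c + c') := by
  refine ⟨hf.contDiff.add hg.contDiff, by simp [hf.apply_zero, hg.apply_zero], fun h => ?_, ?_⟩
  · rw [fderiv_fun_add (hf.contDiff.differentiable (by simp) _)
      (hg.contDiff.differentiable (by simp) _)]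
    simp only [add_apply, hf.fderiv_apply, hg.fderiv_apply]
    ring
  · have h := hf.contDiff.contDiffAt.laplacian_add (hg.contDiff.contDiffAt (x := 0))
    rw [hf.laplacian_apply, hg.laplacian_apply] at h
    rw [mul_add]
    exact h

theorem mul (hf : HasJet f a p q c) (hg : HasJet g a' p' q' c') :
    HasJet (fun l => f l * g l) (a * a') (a * p' + p * a') (a * q' + q * a')
      (a * c' + c * a' + p * q' + q * p') := by
  have df : ∀ x, DifferentiableAt ℝ f x := hf.contDiff.differentiable (by simp)
  have dg : ∀ x, DifferentiableAt ℝ g x := hg.contDiff.differentiable (by simp)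
  have ddf : DifferentiableAt ℝ (fderiv ℝ f) 0 :=
    (hf.contDiff.fderiv_right (m := 1) (by norm_num)).differentiable (by simp) _
  have ddg : DifferentiableAt ℝ (fderiv ℝ g) 0 :=
    (hg.contDiff.fderiv_right (m := 1) (by norm_num)).differentiable (by simp) _
  have hd : fderiv ℝ (fun l => f l * g l) = fun x => f x • fderiv ℝ g x + g x • fderiv ℝ f x := by
    ext1 x
    exact fderiv_fun_mul (df x) (dg x)
  refine ⟨hf.contDiff.mul hg.contDiff, by simp [hf.apply_zero, hg.apply_zero], fun h => ?_, ?_⟩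
  · simp only [hd, add_apply, smul_apply, smul_eq_mul,
      hf.fderiv_apply, hg.fderiv_apply, hf.apply_zero, hg.apply_zero]
    ring
  · have key : ∀ h : ℂ, fderiv ℝ (fderiv ℝ (fun l => f l * g l)) 0 h h =
        a * fderiv ℝ (fderiv ℝ g) 0 h h + a' * fderiv ℝ (fderiv ℝ f) 0 h h +
          2 * (fderiv ℝ f 0 h * fderiv ℝ g 0 h) := by
      intro h
      rw [hd, fderiv_fun_add ((df 0).fun_smul ddg) ((dg 0).fun_smul ddf), fderiv_fun_smul (df 0) ddg,
        fderiv_fun_smul (dg 0) ddf]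
      simp only [add_apply, smul_apply, smul_eq_mul,
        ContinuousLinearMap.smulRight_apply, hf.apply_zero, hg.apply_zero]
      ring
    have lf := hf.laplacian_apply
    have lg := hg.laplacian_apply
    simp only [InnerProductSpace.laplacian_eq_iteratedFDeriv_complexPlane,
      iteratedFDeriv_two_apply, Matrix.cons_val_zero, Matrix.cons_val_one] at lf lg ⊢
    rw [key, key, hf.fderiv_apply, hg.fderiv_apply, hf.fderiv_apply, hg.fderiv_apply]
    simp only [map_one, Complex.conj_I]
    linear_combination a * lg + a' * lf + 2 * (p - q) * (p' - q') * Complex.I_sq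

theorem conjugate (hf : HasJet f a p q c) :
    HasJet (fun l => conj (f l)) (conj a) (conj q) (conj p) (conj c) := by
  refine ⟨Complex.conjCLE.contDiff.comp hf.contDiff, by simp [hf.apply_zero], fun h => ?_, ?_⟩
  · have h1 : HasFDerivAt (fun l => Complex.conjCLE (f l))
        ((Complex.conjCLE : ℂ →L[ℝ] ℂ).comp (fderiv ℝ f 0)) 0 :=
      Complex.conjCLE.hasFDerivAt.comp 0 (hf.contDiff.differentiable (by simp) _).hasFDerivAt
    have h2 := congrArg (fun L => L h) h1.fderiv
    simp only [Complex.conjCLE_apply] at h2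
    rw [h2]
    simp [hf.fderiv_apply, add_comm]
  · have h := InnerProductSpace.laplacian_CLE_comp_left (f := f) (l := Complex.conjCLE)
    have h2 := congrFun h 0
    simp only [Function.comp_apply, hf.laplacian_apply, Complex.conjCLE_apply, map_mul] at h2
    rw [show (starRingEnd ℂ) (4 : ℂ) = 4 from map_ofNat _ 4] at h2
    exact h2

theorem const_mul (b : ℂ) (hf : HasJet f a p q c) :
    HasJet (fun l => b * f l) (b * a) (b * p) (b * q) (b * c) := by
  refine ((affine b 0).mul hf).congr ?_ ?_ ?_ ?_ |> fun h => by simpa using h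
  all_goals simp

theorem sub (hf : HasJet f a p q c) (hg : HasJet g a' p' q' c') :
    HasJet (fun l => f l - g l) (a - a') (p - p') (q - q') (c - c') := by
  simpa [sub_eq_add_neg] using hf.add (hg.const_mul (-1))

/-- The Laplacian of `|f|²`. -/
theorem normSq (hf : HasJet f a p q c) :
    HasJet (fun l => (Complex.normSq (f l) : ℂ)) (Complex.normSq a)
      (a * conj q + p * conj a) (a * conj p + q * conj a)
      ((Complex.normSq p + Complex.normSq q + 2 * (conj a * c).re : ℝ) : ℂ) := by
  have h := hf.mul hf.conjugate
  simp only [Complex.mul_conj] at h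
  refine h.congr rfl rfl rfl ?_
  push_cast
  have : ((2 * (conj a * c).re : ℝ) : ℂ) = a * conj c + c * conj a := by
    apply Complex.ext <;> simp <;> ring
  push_cast at this
  rw [this]
  ring

theorem im (hf : HasJet f a p q c) :
    HasJet (fun l => ((f l).im : ℂ)) a.im (-(Complex.I / 2) * (p - conj q))
      (-(Complex.I / 2) * (q - conj p)) c.im := by
  have h := (hf.sub hf.conjugate).const_mul (-(Complex.I / 2))
  have key : ∀ w : ℂ, -(Complex.I / 2) * (w - conj w) = w.im := by
    intro w
    apply Complex.ext <;> simp
    ring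
  simp only [key] at h
  exact h

theorem laplacian_re (hf : HasJet f a p q c) :
    Laplacian.laplacian (fun l => (f l).re) 0 = 4 * c.re := by
  have h := hf.contDiff.contDiffAt.laplacian_CLM_comp_left (x := 0) (l := Complex.reCLM)
  simpa [Function.comp_def, hf.laplacian_apply] using h

end HasJet

theorem block_form_lower_bound {z W A f g x a t : ℝ} (hz : 0 ≤ z) (hW : 0 ≤ W) (hA : 0 ≤ A)
    (hf : 0 ≤ f) (hg : 0 ≤ g) (hx : 0 ≤ x) (ha : 0 ≤ a) (ht : 0 ≤ t)
    (hz' : z ≤ 1 / 64) (hW' : W ≤ 1 / 64) (hA' : A ≤ 1 / 64)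
    (hg' : g ≤ 1 / 64) (hWA : W ≤ A + z) (hgf : g ≤ f + z * A) :
    (f ^ 2 + W ^ 4 / 8) * x ^ 2 + t ^ 2 / 8 - z ^ 2 * x ^ 2 ≤
      2 * a ^ 2 + (t ^ 2 / 2 - 2 * f * a * x)
      + (W ^ 2 * A ^ 2 * x ^ 2 - 2 * W ^ 2 * f * (x ^ 2 + a * x) - 2 * W * f * A * a * x)
      - (2 * g ^ 2 * f * (x ^ 2 + a * x) + 2 * g * f * A * (t + z * a + W * x) * x)
      + 16 * (f ^ 2 * x ^ 2 / 2 - 2 * z ^ 2 * t ^ 2 - z ^ 2 * A ^ 2 * x ^ 2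
        - 2 * z ^ 2 * f * (x ^ 2 + a * x) - 2 * z * f * A * x ^ 2) := by
  have sq_le : ∀ {u v : ℝ}, 0 ≤ u → 0 ≤ v → u ≤ 1 / 64 → v ≤ 1 / 64 → u * v ≤ 1 / 4096 := by
    intro u v hu hv hu' hv'
    calc u * v ≤ 1 / 64 * (1 / 64) := by gcongr
      _ = 1 / 4096 := by norm_num
  have hX : 0 ≤ f * x := by positivity
  have hY : 0 ≤ z * x := by positivity
  have h1 : (2 * W ^ 2 + 2 * W * A + 2 * g ^ 2 + 2 * g * A * z + 32 * z ^ 2) * ((f * x) * a) ≤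
      1 / 50 * ((f * x) * a) := by
    gcongr
    have := sq_le hW hW hW' hW'
    have := sq_le hW hA hW' hA'
    have := sq_le hg hg hg' hg'
    have h4 := sq_le hg hA hg' hA'
    have := sq_le hz hz hz' hz'
    have : g * A * z ≤ 1 / 4096 * 1 := by gcongr; linarith
    linarith
  have h2 : W ^ 2 * (W ^ 2 / 2 - z ^ 2) ≤ W ^ 2 * A ^ 2 := by
    gcongr
    nlinarith [sq_nonneg (A - z)]
  have h2' := mul_le_mul_of_nonneg_right h2 (sq_nonneg x)
  have h3 : W ^ 2 * z ^ 2 * x ^ 2 ≤ 1 / 4096 * (z * x) ^ 2 := by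
    have := mul_le_mul_of_nonneg_right (sq_le hW hW hW' hW') (sq_nonneg (z * x))
    linarith
  have h4 : 2 * W ^ 2 * f * x ^ 2 ≤ (W ^ 2 * x) ^ 2 / 4 + 4 * (f * x) ^ 2 := by
    linarith [two_mul_le_add_sq (W ^ 2 * x / 2) (2 * (f * x))]
  have hgx : g * x ≤ f * x + z * x := by
    have : z * A ≤ z * 1 := by gcongr; linarith
    calc g * x ≤ (f + z * 1) * x := by gcongr; linarith
      _ = f * x + z * x := by ring
  have h5 : 2 * g ^ 2 * f * x ^ 2 ≤ 1 / 16 * ((f * x + z * x) * (f * x)) := by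
    calc 2 * g ^ 2 * f * x ^ 2 = 2 * g * ((g * x) * (f * x)) := by ring
      _ ≤ 2 * (1 / 64) * ((f * x + z * x) * (f * x)) := by gcongr
      _ ≤ _ := by linarith [mul_nonneg (add_nonneg hX hY) hX]
  have h6 : 2 * g * f * A * t * x ≤ 1 / 16 * ((f * x) * t) := by
    calc 2 * g * f * A * t * x = 2 * (g * A) * ((f * x) * t) := by ring
      _ ≤ 2 * (1 / 4096) * ((f * x) * t) := by gcongr; exact sq_le hg hA hg' hA'
      _ ≤ _ := by linarith [mul_nonneg hX ht]
  have h7 : 2 * g * f * A * (W * x) * x ≤ 1 / 16 * ((f * x + z * x) * (f * x)) := by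
    calc 2 * g * f * A * (W * x) * x = 2 * (A * W) * ((g * x) * (f * x)) := by ring
      _ ≤ 2 * (1 / 4096) * ((f * x + z * x) * (f * x)) := by
        gcongr; exact sq_le hA hW hA' hW'
      _ ≤ _ := by linarith [mul_nonneg (add_nonneg hX hY) hX]
  have h8 : 2 * z ^ 2 * t ^ 2 ≤ 1 / 2048 * t ^ 2 := by
    have := mul_le_mul_of_nonneg_right (sq_le hz hz hz' hz') (sq_nonneg t)
    linarith
  have h9 : z ^ 2 * A ^ 2 * x ^ 2 ≤ 1 / 4096 * (z * x) ^ 2 := by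
    have := mul_le_mul_of_nonneg_right (sq_le hA hA hA' hA') (sq_nonneg (z * x))
    linarith
  have h10 : 2 * z ^ 2 * f * x ^ 2 ≤ 1 / 32 * ((z * x) * (f * x)) := by
    have := mul_le_mul_of_nonneg_right hz' (mul_nonneg hY hX)
    linarith
  have h11 : 2 * z * f * A * x ^ 2 ≤ 1 / 32 * ((z * x) * (f * x)) := by
    have := mul_le_mul_of_nonneg_right hA' (mul_nonneg hY hX)
    linarith
  have h12 : (f * x) * a ≤ ((f * x) ^ 2 + a ^ 2) / 2 := by linarith [two_mul_le_add_sq (f * x) a]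
  have h13 : (f * x) * (z * x) ≤ ((f * x) ^ 2 + (z * x) ^ 2) / 2 := by
    linarith [two_mul_le_add_sq (f * x) (z * x)]
  have h14 : (f * x) * t ≤ ((f * x) ^ 2 + t ^ 2) / 2 := by linarith [two_mul_le_add_sq (f * x) t]
  have := sq_nonneg a
  have := sq_nonneg t
  have := sq_nonneg (f * x)
  have := sq_nonneg (z * x)
  have := sq_nonneg (W ^ 2 * x)
  linarith

/-- `f : ℂ → ℝ` is of class `C²` and `∂²f/∂λ∂λ̄ = L` at the origin. -/
def HasLevi (f : ℂ → ℝ) (L : ℝ) : Prop :=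
  ContDiff ℝ 2 f ∧ Laplacian.laplacian f 0 = 4 * L

namespace HasLevi

variable {f g : ℂ → ℝ} {L M : ℝ}

theorem add (hf : HasLevi f L) (hg : HasLevi g M) : HasLevi (fun l => f l + g l) (L + M) := by
  refine ⟨hf.1.add hg.1, ?_⟩
  have h := hf.1.contDiffAt.laplacian_add (hg.1.contDiffAt (x := 0))
  rw [hf.2, hg.2] at h
  rw [mul_add]
  exact h

theorem const_mul (b : ℝ) (hf : HasLevi f L) : HasLevi (fun l => b * f l) (b * L) := by
  refine ⟨contDiff_const.mul hf.1, ?_⟩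
  have h := InnerProductSpace.laplacian_smul b (hf.1.contDiffAt (x := 0))
  rw [hf.2, smul_eq_mul] at h
  rw [mul_left_comm]
  exact h

theorem sum {ι : Type*} (s : Finset ι) {f : ι → ℂ → ℝ} {L : ι → ℝ}
    (h : ∀ i ∈ s, HasLevi (f i) (L i)) :
    HasLevi (fun l => ∑ i ∈ s, f i l) (∑ i ∈ s, L i) := by
  classical
  induction s using Finset.induction_on with
  | empty =>
    refine ⟨by simpa using contDiff_const, ?_⟩
    simp [InnerProductSpace.laplacian_const]
  | insert i s hi ih =>
    simp only [Finset.sum_insert hi]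
    exact (h i (by simp)).add (ih fun j hj => h j (by simp [hj]))

end HasLevi

namespace HasJet

variable {f g : ℂ → ℂ} {a p q c : ℂ}

theorem hasLevi_norm_sq (hf : HasJet f a p q c) :
    HasLevi (fun l => ‖f l‖ ^ 2) (‖p‖ ^ 2 + ‖q‖ ^ 2 + 2 * (conj a * c).re) := by
  refine ⟨hf.contDiff.norm_sq ℝ, ?_⟩
  have h := hf.normSq.laplacian_re
  simp only [Complex.ofReal_re, Complex.normSq_eq_norm_sq] at h
  exact h

theorem hasLevi_im_sq (hf : HasJet f a p q c) :
    HasLevi (fun l => (f l).im ^ 2) (‖p - conj q‖ ^ 2 / 2 + 2 * (a.im * c.im)) := by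
  have h := hf.im.hasLevi_norm_sq
  simp only [Complex.norm_real, Real.norm_eq_abs, sq_abs] at h
  have h1 : ‖q - conj p‖ = ‖p - conj q‖ := by
    rw [← Complex.norm_conj, map_sub, Complex.conj_conj, norm_sub_rev]
  convert h using 1
  simp only [norm_mul, norm_neg, norm_div, Complex.norm_I, h1, Complex.conj_ofReal,
    ← Complex.ofReal_mul, Complex.ofReal_re, Complex.norm_ofNat]
  ring

end HasJet

theorem neg_norm_le_re (w : ℂ) : -‖w‖ ≤ w.re := (abs_le.1 (Complex.abs_re_le_norm w)).1

theorem norm_sq_add_ge (u v : ℂ) : ‖u‖ ^ 2 / 2 - ‖v‖ ^ 2 ≤ ‖u + v‖ ^ 2 := by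
  have h : ‖u‖ ≤ ‖u + v‖ + ‖v‖ := by simpa using norm_sub_le (u + v) v
  have h2 : ‖u‖ ^ 2 ≤ (‖u + v‖ + ‖v‖) ^ 2 := by gcongr
  linarith [two_mul_le_add_sq ‖u + v‖ ‖v‖]

/-- A lower bound for the Levi form of `(1 + |z|²) (Im w)²`. -/
theorem exists_hasLevi_im_weighted (z w x y : ℂ) (hz : ‖z‖ ≤ 1 / 64) :
    ∃ L, HasLevi (fun l => (1 + ‖z + l * x‖ ^ 2) * (w + l * y).im ^ 2) L ∧
      ‖y‖ ^ 2 / 4 + w.im ^ 2 * ‖x‖ ^ 2 / 4 ≤ L := by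
  have hw := (HasJet.affine w y)
  have hzw := ((HasJet.affine z x).mul hw.im).hasLevi_norm_sq
  have h := hw.hasLevi_im_sq.add hzw
  refine ⟨_, by
    convert h using 2 with l
    rw [norm_mul, mul_pow, Complex.norm_real, Real.norm_eq_abs, sq_abs]
    ring, ?_⟩
  simp only [map_zero, sub_zero, zero_sub, Complex.zero_im, mul_zero, add_zero, zero_mul, zero_add,
    Complex.ofReal_zero]
  set v : ℝ := w.im
  have hv : ‖(v : ℂ)‖ ^ 2 = v ^ 2 := by simp
  have e1 : ‖z * (-(Complex.I / 2) * y)‖ = ‖z‖ * ‖y‖ / 2 := by simp; ring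
  have e2 : ‖z * (-(Complex.I / 2) * -conj y)‖ = ‖z‖ * ‖y‖ / 2 := by simp; ring
  have e3 := norm_sq_add_ge (x * (v : ℂ)) (z * (-(Complex.I / 2) * y))
  rw [add_comm, e1, norm_mul, mul_pow, hv] at e3
  have e4 := neg_norm_le_re (conj (z * (v : ℂ)) * (x * (-(Complex.I / 2) * -conj y)))
  have e5 : ‖conj (z * (v : ℂ)) * (x * (-(Complex.I / 2) * -conj y))‖ =
      (‖x‖ * |v|) * (‖z‖ * ‖y‖) / 2 := by simp; ring
  rw [e5] at e4
  rw [e2]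
  have e6 : ‖z‖ ^ 2 * ‖y‖ ^ 2 ≤ 1 / 4 * ‖y‖ ^ 2 := by
    gcongr
    nlinarith [norm_nonneg z]
  have e7 := two_mul_le_add_sq (‖x‖ * |v| / 2) (‖z‖ * ‖y‖)
  rw [div_pow, mul_pow, mul_pow, sq_abs] at e7
  linarith

section Block

variable {F g : ℂ → ℂ} {f A a t x g₀ g₁ : ℂ} {δ : ℝ}

theorem exists_hasLevi_im_sq
    (hF : HasJet F f (t - conj A * x) (-(A * conj x)) (-((δ * x + a) * conj x))) :
    ∃ L, HasLevi (fun l => (F l).im ^ 2) L ∧ ‖t‖ ^ 2 / 2 - 2 * ‖f‖ * ‖a‖ * ‖x‖ ≤ L := by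
  refine ⟨_, hF.hasLevi_im_sq, ?_⟩
  have h1 : t - conj A * x - conj (-(A * conj x)) = t := by simp
  have h2 : (-((δ * x + a) * conj x)).im = -(a * conj x).im := by simp; ring
  rw [h1, h2]
  have h3 : |f.im * (a * conj x).im| ≤ ‖f‖ * ‖a * conj x‖ := by
    rw [abs_mul]
    gcongr
    · exact Complex.abs_im_le_norm f
    · exact Complex.abs_im_le_norm _
  rw [norm_mul, Complex.norm_conj] at h3
  linarith [le_abs_self (f.im * (a * conj x).im)]

theorem exists_hasLevi_norm_mul_sq (hδ : 0 ≤ δ) (hδ' : δ ≤ 1)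
    (hF : HasJet F f (t - conj A * x) (-(A * conj x)) (-((δ * x + a) * conj x)))
    (hg : HasJet g g₀ g₁ 0 0) :
    ∃ L, HasLevi (fun l => ‖g l‖ ^ 2 * ‖F l‖ ^ 2) L ∧
      ‖g₁ * f + g₀ * (t - conj A * x)‖ ^ 2 + ‖g₀‖ ^ 2 * ‖A‖ ^ 2 * ‖x‖ ^ 2
        - 2 * ‖g₀‖ ^ 2 * ‖f‖ * (‖x‖ ^ 2 + ‖a‖ * ‖x‖) - 2 * ‖g₀‖ * ‖f‖ * ‖g₁‖ * ‖A‖ * ‖x‖ ≤ L := by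
  have h := (hg.mul hF).hasLevi_norm_sq
  simp only [norm_mul, mul_pow] at h
  refine ⟨_, h, ?_⟩
  have e1 := neg_norm_le_re (conj (g₀ * f) * (g₀ * -((δ * x + a) * conj x) + 0 * f +
    g₁ * -(A * conj x) + 0 * (t - conj A * x)))
  have e2 : ‖δ * x + a‖ ≤ ‖x‖ + ‖a‖ := by
    refine (norm_add_le _ _).trans ?_
    gcongr
    rw [norm_mul, Complex.norm_real, Real.norm_of_nonneg hδ]
    exact mul_le_of_le_one_left (norm_nonneg x) hδ'
  have e3 : ‖conj (g₀ * f) * (g₀ * -((δ * x + a) * conj x) + 0 * f +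
      g₁ * -(A * conj x) + 0 * (t - conj A * x))‖ ≤
      ‖g₀‖ * ‖f‖ * (‖g₀‖ * ((‖x‖ + ‖a‖) * ‖x‖) + ‖g₁‖ * (‖A‖ * ‖x‖)) := by
    rw [norm_mul, Complex.norm_conj, norm_mul]
    gcongr
    simp only [zero_mul, add_zero]
    refine (norm_add_le _ _).trans ?_
    simp only [norm_mul, norm_neg, Complex.norm_conj]
    gcongr
  have e4 : ‖g₀ * -(A * conj x) + 0 * f‖ ^ 2 = ‖g₀‖ ^ 2 * ‖A‖ ^ 2 * ‖x‖ ^ 2 := by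
    simp [mul_pow]
    ring
  rw [e4, add_comm (g₀ * _) (g₁ * f)]
  linarith

end Block

/-- A function vanishing exactly where `Im w₁ = Im w₂ = 0` and `ζ = z̄ (δ z + w₁ + i w₂)`. -/
def blockFun (δ : ℝ) (z w₁ w₂ ζ : ℂ) : ℝ :=
  32 * ((1 + ‖z‖ ^ 2) * w₁.im ^ 2 + (1 + ‖z‖ ^ 2) * w₂.im ^ 2)
  + (ζ - conj z * (δ * z + (w₁ + Complex.I * w₂))).im ^ 2
  + (‖w₁ + Complex.I * w₂‖ ^ 2 * ‖ζ - conj z * (δ * z + (w₁ + Complex.I * w₂))‖ ^ 2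
    + ‖ζ‖ ^ 2 * ‖ζ - conj z * (δ * z + (w₁ + Complex.I * w₂))‖ ^ 2
    + 16 * (‖z‖ ^ 2 * ‖ζ - conj z * (δ * z + (w₁ + Complex.I * w₂))‖ ^ 2))

theorem exists_hasLevi_blockFun {δ : ℝ} (hδ : 0 ≤ δ) (hδ' : δ ≤ 1) {z w₁ w₂ ζ : ℂ}
    (x y₁ y₂ s : ℂ) (hz : ‖z‖ ≤ 1 / 256) (hw₁ : ‖w₁‖ ≤ 1 / 256) (hw₂ : ‖w₂‖ ≤ 1 / 256)
    (hζ : ‖ζ‖ ≤ 1 / 256) :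
    ∃ L, HasLevi (fun l => blockFun δ (z + l * x) (w₁ + l * y₁) (w₂ + l * y₂) (ζ + l * s)) L ∧
      (‖ζ - conj z * (δ * z + (w₁ + Complex.I * w₂))‖ ^ 2 + ‖w₁ + Complex.I * w₂‖ ^ 4 / 8
        + w₁.im ^ 2 + w₂.im ^ 2) * ‖x‖ ^ 2 + (‖y₁‖ ^ 2 + ‖y₂‖ ^ 2)
        + ‖s - conj z * (y₁ + Complex.I * y₂) + conj (w₁ + Complex.I * w₂) * x‖ ^ 2 / 8
        - ‖z‖ ^ 2 * ‖x‖ ^ 2 ≤ L := by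
  have jz := HasJet.affine z x
  have jζ := HasJet.affine ζ s
  have jW := (HasJet.affine w₁ y₁).add ((HasJet.affine w₂ y₂).const_mul Complex.I)
  have jA := (jz.const_mul (δ : ℂ)).add jW
  have jF := jζ.sub (jz.conjugate.mul jA)
  set W := w₁ + Complex.I * w₂ with hW
  set a := y₁ + Complex.I * y₂ with ha
  set A := δ * z + W with hA
  set f := ζ - conj z * A with hf
  set t := s - conj z * a + conj W * x with ht
  replace jW := jW.congr rfl rfl (q' := 0) (c' := 0) (by simp) (by simp)
  replace jF := jF.congr rfl (p' := t - conj A * x) (q' := -(A * conj x))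
    (c' := -((δ * x + a) * conj x)) (by simp [ht, hA]; ring) (by simp; ring) (by simp; ring)
  obtain ⟨L₁, h₁, b₁⟩ := exists_hasLevi_im_weighted z w₁ x y₁ (by linarith)
  obtain ⟨L₂, h₂, b₂⟩ := exists_hasLevi_im_weighted z w₂ x y₂ (by linarith)
  obtain ⟨L₃, h₃, b₃⟩ := exists_hasLevi_im_sq jF
  obtain ⟨L₄, h₄, b₄⟩ := exists_hasLevi_norm_mul_sq hδ hδ' jF jW
  obtain ⟨L₅, h₅, b₅⟩ := exists_hasLevi_norm_mul_sq hδ hδ' jF jζ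
  obtain ⟨L₆, h₆, b₆⟩ := exists_hasLevi_norm_mul_sq hδ hδ' jF jz
  refine ⟨_, ((((h₁.add h₂).const_mul 32).add h₃).add ((h₄.add h₅).add (h₆.const_mul 16))), ?_⟩
  have nW : ‖W‖ ≤ 1 / 128 := by
    refine (norm_add_le _ _).trans ?_
    rw [norm_mul, Complex.norm_I]
    linarith
  have nδz : ‖(δ : ℂ) * z‖ ≤ ‖z‖ := by
    rw [norm_mul, Complex.norm_real, Real.norm_of_nonneg hδ]
    exact mul_le_of_le_one_left (norm_nonneg z) hδ'
  have nA : ‖A‖ ≤ 1 / 64 := by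
    refine (norm_add_le _ _).trans ?_
    linarith
  have nWA : ‖W‖ ≤ ‖A‖ + ‖z‖ := by
    have : W = A - δ * z := by simp [hA]
    rw [this]
    exact (norm_sub_le _ _).trans (by gcongr)
  have nζf : ‖ζ‖ ≤ ‖f‖ + ‖z‖ * ‖A‖ := by
    have : ζ = f + conj z * A := by simp [hf]
    nth_rw 1 [this]
    refine (norm_add_le _ _).trans ?_
    rw [norm_mul, Complex.norm_conj]
  have ns : ‖s‖ ≤ ‖t‖ + ‖z‖ * ‖a‖ + ‖W‖ * ‖x‖ := by
    have : s = t + conj z * a - conj W * x := by rw [ht]; ring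
    nth_rw 1 [this]
    refine (norm_sub_le _ _).trans ?_
    rw [norm_mul (conj W), Complex.norm_conj]
    gcongr
    refine (norm_add_le _ _).trans ?_
    rw [norm_mul, Complex.norm_conj]
  have na : ‖a‖ ^ 2 ≤ 2 * (‖y₁‖ ^ 2 + ‖y₂‖ ^ 2) := by
    have h : ‖a‖ ≤ ‖y₁‖ + ‖y₂‖ := by
      refine (norm_add_le _ _).trans ?_
      rw [norm_mul, Complex.norm_I, one_mul]
    have h2 : ‖a‖ ^ 2 ≤ (‖y₁‖ + ‖y₂‖) ^ 2 := by gcongr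
    linarith [two_mul_le_add_sq ‖y₁‖ ‖y₂‖]
  have key := block_form_lower_bound (norm_nonneg z) (norm_nonneg W) (norm_nonneg A)
    (norm_nonneg f) (norm_nonneg ζ) (norm_nonneg x) (norm_nonneg a) (norm_nonneg t)
    (by linarith) (by linarith) nA (by linarith) nWA nζf
  have c₅ : 2 * ‖ζ‖ * ‖f‖ * ‖s‖ * ‖A‖ * ‖x‖ ≤
      2 * ‖ζ‖ * ‖f‖ * (‖t‖ + ‖z‖ * ‖a‖ + ‖W‖ * ‖x‖) * ‖A‖ * ‖x‖ := by gcongr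
  have c₆ := norm_sq_add_ge (x * f) (z * (t - conj A * x))
  have c₆' : ‖z * (t - conj A * x)‖ ^ 2 ≤
      2 * ‖z‖ ^ 2 * ‖t‖ ^ 2 + 2 * ‖z‖ ^ 2 * ‖A‖ ^ 2 * ‖x‖ ^ 2 := by
    have h : ‖t - conj A * x‖ ≤ ‖t‖ + ‖A‖ * ‖x‖ := by
      refine (norm_sub_le _ _).trans ?_
      rw [norm_mul, Complex.norm_conj]
    have h2 : ‖t - conj A * x‖ ^ 2 ≤ (‖t‖ + ‖A‖ * ‖x‖) ^ 2 := by gcongr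
    have h3 : ‖t - conj A * x‖ ^ 2 ≤ 2 * ‖t‖ ^ 2 + 2 * (‖A‖ * ‖x‖) ^ 2 := by
      linarith [two_mul_le_add_sq ‖t‖ (‖A‖ * ‖x‖)]
    rw [norm_mul, mul_pow]
    have h4 := mul_le_mul_of_nonneg_left h3 (sq_nonneg ‖z‖)
    linarith
  rw [norm_mul, mul_pow] at c₆
  have p₄ : 0 ≤ ‖a * f + W * (t - conj A * x)‖ ^ 2 := by positivity
  have p₅ : 0 ≤ ‖s * f + ζ * (t - conj A * x)‖ ^ 2 := by positivity
  have p₆ : 0 ≤ ‖ζ‖ ^ 2 * ‖A‖ ^ 2 * ‖x‖ ^ 2 := by positivity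
  have p₇ : 0 ≤ w₁.im ^ 2 * ‖x‖ ^ 2 := by positivity
  have p₈ : 0 ≤ w₂.im ^ 2 * ‖x‖ ^ 2 := by positivity
  linarith [sq_nonneg ‖y₁‖, sq_nonneg ‖y₂‖]

/-- The lower bound for the Levi form of `(1 + |z|²) |ζ - z̄²|²`. -/
theorem exists_hasLevi_conj_sq {z : ℂ} (ζ x s : ℂ) (hz : ‖z‖ ≤ 1 / 256) (hζ : ‖ζ‖ ≤ 1 / 256) :
    ∃ L, HasLevi (fun l => (1 + ‖z + l * x‖ ^ 2) * ‖ζ + l * s - conj (z + l * x) ^ 2‖ ^ 2) L ∧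
      ‖s‖ ^ 2 / 2 + 2 * (‖z‖ ^ 2 * ‖x‖ ^ 2) + ‖ζ - conj z ^ 2‖ ^ 2 * ‖x‖ ^ 2 / 2 ≤ L := by
  have jz := HasJet.affine z x
  have jF := (HasJet.affine ζ s).sub (jz.conjugate.mul jz.conjugate)
  simp only [← sq] at jF
  replace jF := jF.congr rfl (p' := s) (q' := -(2 * conj z * conj x)) (c' := 0) (by simp)
    (by simp; ring) (by simp)
  have h := jF.hasLevi_norm_sq.add (jz.mul jF).hasLevi_norm_sq
  refine ⟨_, by
    convert h using 2 with l
    rw [norm_mul, mul_pow]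
    ring, ?_⟩
  set f := ζ - conj z ^ 2 with hf
  have nf : ‖f‖ ≤ 1 / 64 := by
    refine (norm_sub_le _ _).trans ?_
    rw [norm_pow, Complex.norm_conj]
    nlinarith [norm_nonneg z]
  have e1 : ‖-(2 * conj z * conj x)‖ ^ 2 = 4 * (‖z‖ ^ 2 * ‖x‖ ^ 2) := by
    simp [mul_pow]
    ring
  have e2 := norm_sq_add_ge (x * f) (z * s)
  rw [norm_mul, norm_mul, mul_pow, mul_pow, add_comm (x * f)] at e2
  have e3 := neg_norm_le_re (conj (z * f) * (z * 0 + 0 * f + x * -(2 * conj z * conj x) + 0 * s))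
  have e4 : ‖conj (z * f) * (z * 0 + 0 * f + x * -(2 * conj z * conj x) + 0 * s)‖ =
      2 * ‖f‖ * (‖z‖ ^ 2 * ‖x‖ ^ 2) := by
    simp
    ring
  have e5 : 2 * ‖f‖ * (‖z‖ ^ 2 * ‖x‖ ^ 2) ≤ 2 * (1 / 64) * (‖z‖ ^ 2 * ‖x‖ ^ 2) := by gcongr
  have e6 : ‖z‖ ^ 2 * ‖s‖ ^ 2 ≤ 1 / 4 * ‖s‖ ^ 2 := by
    gcongr
    nlinarith [norm_nonneg z]
  have e7 : 0 ≤ ‖z‖ ^ 2 * ‖x‖ ^ 2 := by positivity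
  have e8 : 0 ≤ ‖z * -(2 * conj z * conj x) + 0 * f‖ ^ 2 := by positivity
  simp only [mul_zero, Complex.zero_re] at *
  nlinarith [sq_nonneg ‖s‖]

theorem sliceLaplacian_eq_laplacian {n : ℕ} (ρ : EuclideanSpace ℂ (Fin n) → ℝ)
    (p v : EuclideanSpace ℂ (Fin n)) :
    sliceLaplacian ρ p v = Laplacian.laplacian (fun l : ℂ => ρ (p + l • v)) 0 := by
  simp [sliceLaplacian, InnerProductSpace.laplacian_eq_iteratedFDeriv_complexPlane]

theorem two_le_infty : (2 : WithTop ℕ∞) ≤ ((⊤ : ℕ∞) : WithTop ℕ∞) :=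
  WithTop.coe_le_coe.2 le_top

section Extension

variable {n : ℕ} {φ χ : EuclideanSpace ℂ (Fin n) → ℝ}

theorem contDiff_slice {m : WithTop ℕ∞} (hφ : ContDiff ℝ m φ) (p v : EuclideanSpace ℂ (Fin n)) :
    ContDiff ℝ m (fun l : ℂ => φ (p + l • v)) :=
  hφ.comp (contDiff_const.add (contDiff_id.smul contDiff_const))

theorem sliceLaplacian_add (hφ : ContDiff ℝ 2 φ) (hχ : ContDiff ℝ 2 χ)
    (p v : EuclideanSpace ℂ (Fin n)) :
    sliceLaplacian (fun z => φ z + χ z) p v = sliceLaplacian φ p v + sliceLaplacian χ p v := by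
  simp only [sliceLaplacian_eq_laplacian]
  exact (contDiff_slice hφ p v).contDiffAt.laplacian_add (contDiff_slice hχ p v).contDiffAt

theorem sliceLaplacian_congr {p : EuclideanSpace ℂ (Fin n)} (h : φ =ᶠ[nhds p] χ)
    (v : EuclideanSpace ℂ (Fin n)) : sliceLaplacian φ p v = sliceLaplacian χ p v := by
  simp only [sliceLaplacian_eq_laplacian]
  refine (InnerProductSpace.laplacian_congr_nhds ?_).eq_of_nhds
  have hc : Filter.Tendsto (fun l : ℂ => p + l • v) (nhds 0) (nhds p) := by
    have : Continuous fun l : ℂ => p + l • v := by fun_prop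
    simpa using this.tendsto 0
  exact hc.eventually h

theorem exists_abs_sliceLaplacian_le (hφ : ContDiff ℝ 2 φ) (hc : HasCompactSupport φ) :
    ∃ M : ℝ, ∀ p v, |sliceLaplacian φ p v| ≤ M * ‖v‖ ^ 2 := by
  obtain ⟨M, hM⟩ := (hc.iteratedFDeriv (𝕜 := ℝ) 2).exists_bound_of_continuous
    (hφ.continuous_iteratedFDeriv le_rfl)
  refine ⟨2 * M, fun p v => ?_⟩
  let S : ℂ →L[ℝ] EuclideanSpace ℂ (Fin n) :=
    (ContinuousLinearMap.toSpanSingleton ℂ v).restrictScalars ℝ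
  have hS : ∀ l, S l = l • v := fun l => by simp [S]
  have key : ∀ u : ℂ, ‖u‖ = 1 →
      |iteratedFDeriv ℝ 2 (fun l : ℂ => φ (p + l • v)) 0 ![u, u]| ≤ M * ‖v‖ ^ 2 := by
    intro u hu
    have h1 : (fun l : ℂ => φ (p + l • v)) = (fun y => φ (p + y)) ∘ S := by
      ext l
      simp [hS]
    have h2 : ContDiff ℝ 2 (fun y => φ (p + y)) := hφ.comp (contDiff_const.add contDiff_id)
    rw [h1, S.iteratedFDeriv_comp_right h2 0 le_rfl, iteratedFDeriv_comp_add_left,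
      ContinuousMultilinearMap.compContinuousLinearMap_apply, ← Real.norm_eq_abs]
    refine (ContinuousMultilinearMap.le_opNorm _ _).trans ?_
    have h3 : ∏ i : Fin 2, ‖S (![u, u] i)‖ = ‖v‖ ^ 2 := by
      simp [hS, norm_smul, hu, sq]
    rw [h3]
    gcongr
    exact hM _
  have h1 := key 1 (by simp)
  have h2 := key Complex.I (by simp)
  rw [sliceLaplacian]
  refine (abs_add_le _ _).trans ?_
  linarith

/-- A primitive of `expNegInvGlue`: a smooth convex function vanishing exactly on `(-∞, 0]`. -/
def convexGlue (x : ℝ) : ℝ := ∫ t in (0 : ℝ)..x, expNegInvGlue t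

theorem continuous_expNegInvGlue : Continuous expNegInvGlue :=
  (expNegInvGlue.contDiff (n := 0)).continuous

theorem hasDerivAt_convexGlue (x : ℝ) : HasDerivAt convexGlue (expNegInvGlue x) x :=
  intervalIntegral.integral_hasDerivAt_right (continuous_expNegInvGlue.intervalIntegrable _ _)
    (continuous_expNegInvGlue.stronglyMeasurableAtFilter _ _)
    continuous_expNegInvGlue.continuousAt

theorem contDiff_convexGlue : ContDiff ℝ (⊤ : ℕ∞) convexGlue := by
  rw [contDiff_infty_iff_deriv]
  refine ⟨fun x => (hasDerivAt_convexGlue x).differentiableAt, ?_⟩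
  rw [funext fun x => (hasDerivAt_convexGlue x).deriv]
  exact expNegInvGlue.contDiff

theorem convexGlue_of_nonpos {x : ℝ} (hx : x ≤ 0) : convexGlue x = 0 := by
  rw [convexGlue, intervalIntegral.integral_congr (g := fun _ => (0 : ℝ))]
  · simp
  · intro t ht
    rw [Set.uIcc_of_ge hx] at ht
    exact expNegInvGlue.zero_of_nonpos ht.2

theorem convexGlue_pos {x : ℝ} (hx : 0 < x) : 0 < convexGlue x :=
  intervalIntegral.intervalIntegral_pos_of_pos_on
    (continuous_expNegInvGlue.intervalIntegrable _ _)
    (fun _ ht => expNegInvGlue.pos_of_pos ht.1) hx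

theorem convexGlue_nonneg (x : ℝ) : 0 ≤ convexGlue x :=
  (le_or_gt x 0).elim (fun h => (convexGlue_of_nonpos h).ge) fun h => (convexGlue_pos h).le

theorem laplacian_convexGlue_comp_ge {u : ℂ → ℝ} (hu : ContDiff ℝ 2 u) :
    expNegInvGlue (u 0) * Laplacian.laplacian u 0 ≤
      Laplacian.laplacian (fun l => convexGlue (u l)) 0 := by
  have du : ∀ x, DifferentiableAt ℝ u x := hu.differentiable (by simp)
  have ddu : DifferentiableAt ℝ (fderiv ℝ u) 0 :=
    (hu.fderiv_right (m := 1) (by norm_num)).differentiable (by simp) _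
  have dg : DifferentiableAt ℝ expNegInvGlue (u 0) :=
    (expNegInvGlue.contDiff (n := 1)).differentiable (by simp) _
  have hd : fderiv ℝ (fun l => convexGlue (u l)) = fun x => expNegInvGlue (u x) • fderiv ℝ u x := by
    ext1 x
    exact ((hasDerivAt_convexGlue (u x)).comp_hasFDerivAt x (du x).hasFDerivAt).fderiv
  have hg : HasFDerivAt (fun x => expNegInvGlue (u x))
      (deriv expNegInvGlue (u 0) • fderiv ℝ u 0) 0 :=
    dg.hasDerivAt.comp_hasFDerivAt 0 (du 0).hasFDerivAt
  have key : ∀ h : ℂ, expNegInvGlue (u 0) * fderiv ℝ (fderiv ℝ u) 0 h h ≤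
      fderiv ℝ (fderiv ℝ (fun l => convexGlue (u l))) 0 h h := by
    intro h
    rw [hd, fderiv_fun_smul hg.differentiableAt ddu, hg.fderiv]
    simp only [add_apply, smul_apply, smul_eq_mul, ContinuousLinearMap.smulRight_apply]
    have : 0 ≤ deriv expNegInvGlue (u 0) := expNegInvGlue.monotone.deriv_nonneg
    nlinarith [mul_nonneg this (mul_self_nonneg (fderiv ℝ u 0 h))]
  simp only [InnerProductSpace.laplacian_eq_iteratedFDeriv_complexPlane, iteratedFDeriv_two_apply,
    Matrix.cons_val_zero, Matrix.cons_val_one]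
  linarith [key 1, key Complex.I]

theorem hasLevi_norm_sq_slice (p v : EuclideanSpace ℂ (Fin n)) (b : ℝ) :
    HasLevi (fun l => ‖p + l • v‖ ^ 2 - b) (‖v‖ ^ 2) := by
  have h := HasLevi.sum Finset.univ fun i _ => (HasJet.affine (p i) (v i)).hasLevi_norm_sq
  have hb : HasLevi (fun _ => -b) 0 := ⟨contDiff_const, by simp⟩
  convert h.add hb using 1
  · ext l
    simp [EuclideanSpace.norm_sq_eq, sub_eq_add_neg]
  · simp [EuclideanSpace.norm_sq_eq]

theorem sliceLaplacian_convexGlue_ge {K : ℝ} (hK : 0 ≤ K) (b : ℝ)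
    (p v : EuclideanSpace ℂ (Fin n)) :
    4 * K * expNegInvGlue (‖p‖ ^ 2 - b) * ‖v‖ ^ 2 ≤
      sliceLaplacian (fun z => K * convexGlue (‖z‖ ^ 2 - b)) p v := by
  have hu := hasLevi_norm_sq_slice p v b
  have h := laplacian_convexGlue_comp_ge hu.1
  have hc : ContDiff ℝ 2 (fun l : ℂ => convexGlue (‖p + l • v‖ ^ 2 - b)) :=
    (contDiff_convexGlue.of_le two_le_infty).comp hu.1
  rw [sliceLaplacian_eq_laplacian, (HasLevi.const_mul K ⟨hc, (mul_div_cancel₀ _ four_ne_zero).symm⟩).2]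
  rw [hu.2, zero_smul, add_zero] at h
  have := mul_le_mul_of_nonneg_left h hK
  linarith

/-- A smooth nonnegative function that is strictly p.s.h. near a closed ball centred at `0`,
except possibly at `0`, can be modified off that ball into a global p.s.h. function which does not
vanish off the ball. -/
theorem exists_psh_extension (hφ : ContDiff ℝ (⊤ : ℕ∞) φ) (hφ₀ : ∀ z, 0 ≤ φ z) {r R : ℝ}
    (hr : 0 < r) (hrR : r < R) (hpsh : ∀ p, ‖p‖ ≤ R → ∀ v, 0 ≤ sliceLaplacian φ p v)
    (hstrict : ∀ p, ‖p‖ ≤ R → p ≠ 0 → StrictPshAt φ p) :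
    ∃ ψ : EuclideanSpace ℂ (Fin n) → ℝ, ContDiff ℝ (⊤ : ℕ∞) ψ ∧ PshOn ψ Set.univ ∧
      {z | ψ z = 0} = {z | φ z = 0} ∩ Metric.closedBall 0 r ∧
      (∀ z ∉ {z | φ z = 0} ∩ Metric.closedBall 0 r, 0 < ψ z) ∧
      (∀ z, z ≠ 0 → StrictPshAt ψ z) := by
  let θ : ContDiffBump (0 : EuclideanSpace ℂ (Fin n)) := ⟨R, R + 1, hr.trans hrR, by linarith⟩
  set φ' : EuclideanSpace ℂ (Fin n) → ℝ := fun z => θ z * φ z with hφ'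
  have cφ' : ContDiff ℝ (⊤ : ℕ∞) φ' := θ.contDiff.mul hφ
  have nφ' : ∀ z, 0 ≤ φ' z := fun z => mul_nonneg θ.nonneg (hφ₀ z)
  have eφ' : ∀ z, ‖z‖ ≤ R → φ' z = φ z := fun z hz => by
    rw [hφ']
    simp [θ.one_of_mem_closedBall (by simpa using hz)]
  obtain ⟨M, hM⟩ := exists_abs_sliceLaplacian_le (cφ'.of_le two_le_infty) θ.hasCompactSupport.mul_right
  set R' := (r + R) / 2 with hR'
  have g_pos : 0 < expNegInvGlue (R' ^ 2 - r ^ 2) :=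
    expNegInvGlue.pos_of_pos (by nlinarith)
  set K := (|M| + 1) / expNegInvGlue (R' ^ 2 - r ^ 2) with hK
  have K_pos : 0 < K := by positivity
  set χ : EuclideanSpace ℂ (Fin n) → ℝ := fun z => K * convexGlue (‖z‖ ^ 2 - r ^ 2) with hχ
  have cχ : ContDiff ℝ (⊤ : ℕ∞) χ :=
    contDiff_const.mul (contDiff_convexGlue.comp ((contDiff_norm_sq ℂ).sub contDiff_const))
  have nχ : ∀ z, 0 ≤ χ z := fun z => mul_nonneg K_pos.le (convexGlue_nonneg _)
  have lχ := fun p v : EuclideanSpace ℂ (Fin n) =>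
    sliceLaplacian_convexGlue_ge K_pos.le (r ^ 2) p v
  have lψ := fun p v : EuclideanSpace ℂ (Fin n) =>
    sliceLaplacian_add (cφ'.of_le two_le_infty) (cχ.of_le two_le_infty) p v
  have inner : ∀ p, ‖p‖ < R' → ∀ v,
      sliceLaplacian φ p v ≤ sliceLaplacian (fun z => φ' z + χ z) p v := by
    intro p hp v
    have hn : φ' =ᶠ[nhds p] φ := by
      filter_upwards [(isOpen_lt continuous_norm continuous_const).mem_nhds hp] with z hz
      exact eφ' z (by have : ‖z‖ < R' := hz; linarith)
    have h1 := lχ p v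
    have h2 : 0 ≤ 4 * K * expNegInvGlue (‖p‖ ^ 2 - r ^ 2) * ‖v‖ ^ 2 :=
      mul_nonneg (mul_nonneg (by positivity) (expNegInvGlue.nonneg _)) (by positivity)
    rw [lψ, sliceLaplacian_congr hn]
    linarith
  have outer : ∀ p, R' ≤ ‖p‖ → ∀ v, v ≠ 0 →
      0 < sliceLaplacian (fun z => φ' z + χ z) p v := by
    intro p hp v hv
    have h1 := lχ p v
    have h2 : expNegInvGlue (R' ^ 2 - r ^ 2) ≤ expNegInvGlue (‖p‖ ^ 2 - r ^ 2) :=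
      expNegInvGlue.monotone (by gcongr; linarith)
    have h3 : |M| + 1 ≤ K * expNegInvGlue (‖p‖ ^ 2 - r ^ 2) := by
      calc |M| + 1 = K * expNegInvGlue (R' ^ 2 - r ^ 2) := by rw [hK]; field_simp
        _ ≤ _ := by gcongr
    have hv' : 0 < ‖v‖ ^ 2 := by positivity
    have h4 := mul_le_mul_of_nonneg_right h3 hv'.le
    have h5 := (abs_le.1 (hM p v)).1
    have h6 := mul_le_mul_of_nonneg_right (le_abs_self M) hv'.le
    have h7 := mul_nonneg (abs_nonneg M) hv'.le
    rw [lψ]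
    linarith
  have zero_iff : ∀ z, φ' z + χ z = 0 ↔ φ z = 0 ∧ ‖z‖ ≤ r := by
    intro z
    constructor
    · intro h
      have h1 : χ z = 0 := by linarith [nφ' z, nχ z]
      have h2 : ‖z‖ ≤ r := by
        by_contra! hz
        have : 0 < χ z := mul_pos K_pos (convexGlue_pos (by nlinarith))
        linarith
      exact ⟨by rw [← eφ' z (h2.trans hrR.le)]; linarith, h2⟩
    · rintro ⟨h1, h2⟩
      rw [eφ' z (h2.trans hrR.le), h1, hχ]
      simp [convexGlue_of_nonpos (show ‖z‖ ^ 2 - r ^ 2 ≤ 0 by nlinarith [norm_nonneg z])]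
  refine ⟨fun z => φ' z + χ z, cφ'.add cχ, ?_, ?_, ?_, ?_⟩
  · intro p _ v
    rcases lt_or_ge ‖p‖ R' with hp | hp
    · exact (hpsh p (by linarith) v).trans (inner p hp v)
    · rcases eq_or_ne v 0 with rfl | hv
      · simp [sliceLaplacian_eq_laplacian]
      · exact (outer p hp v hv).le
  · ext z
    simpa using zero_iff z
  · intro z hz
    refine lt_of_le_of_ne (add_nonneg (nφ' z) (nχ z)) fun h => hz ?_
    simpa using (zero_iff z).1 h.symm
  · intro p hp v hv
    rcases lt_or_ge ‖p‖ R' with hpR | hpR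
    · exact (hstrict p (by linarith) hp v hv).trans_le (inner p hpR v)
    · exact outer p hpR v hv

end Extension

theorem blockFun_nonneg (δ : ℝ) (z w₁ w₂ ζ : ℂ) : 0 ≤ blockFun δ z w₁ w₂ ζ := by
  rw [blockFun]
  positivity

theorem blockFun_eq_zero_iff {δ : ℝ} {z w₁ w₂ ζ : ℂ} : blockFun δ z w₁ w₂ ζ = 0 ↔
    w₁.im = 0 ∧ w₂.im = 0 ∧ ζ = conj z * (δ * z + (w₁ + Complex.I * w₂)) := by
  rw [blockFun]
  constructor
  · intro h
    set f := ζ - conj z * (δ * z + (w₁ + Complex.I * w₂)) with hf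
    have p₁ : 0 ≤ ‖z‖ ^ 2 * w₁.im ^ 2 := by positivity
    have p₂ : 0 ≤ ‖z‖ ^ 2 * w₂.im ^ 2 := by positivity
    have p₃ : 0 ≤ ‖w₁ + Complex.I * w₂‖ ^ 2 * ‖f‖ ^ 2 := by positivity
    have p₄ : 0 ≤ ‖ζ‖ ^ 2 * ‖f‖ ^ 2 := by positivity
    have p₅ : 0 ≤ ‖z‖ ^ 2 * ‖f‖ ^ 2 := by positivity
    have p₆ := sq_nonneg w₁.im
    have p₇ := sq_nonneg w₂.im
    have p₈ := sq_nonneg f.im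
    refine ⟨pow_eq_zero_iff two_ne_zero |>.1 (by linarith),
      pow_eq_zero_iff two_ne_zero |>.1 (by linarith), ?_⟩
    rw [← sub_eq_zero, ← hf]
    by_contra hne
    have h₁ : ‖ζ‖ ^ 2 * ‖f‖ ^ 2 = 0 := by linarith
    have h₂ : ‖z‖ ^ 2 * ‖f‖ ^ 2 = 0 := by linarith
    have hζ : ζ = 0 := by simpa [hne] using h₁
    have hz : z = 0 := by simpa [hne] using h₂
    exact hne (by simp [hf, hζ, hz])
  · rintro ⟨h₁, h₂, h₃⟩
    rw [← sub_eq_zero] at h₃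
    simp [h₁, h₂, h₃]

theorem contDiff_conj {m : WithTop ℕ∞} : ContDiff ℝ m (conj : ℂ → ℂ) :=
  Complex.conjCLE.contDiff

theorem ContDiff.complex_im {E : Type*} [NormedAddCommGroup E] [NormedSpace ℝ E]
    {m : WithTop ℕ∞} {f : E → ℂ} (hf : ContDiff ℝ m f) : ContDiff ℝ m fun x => (f x).im :=
  Complex.imCLM.contDiff.comp hf

theorem ContDiff.blockFun {E : Type*} [NormedAddCommGroup E] [NormedSpace ℝ E]
    {m : WithTop ℕ∞} (δ : ℝ) {z w₁ w₂ ζ : E → ℂ} (hz : ContDiff ℝ m z) (hw₁ : ContDiff ℝ m w₁)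
    (hw₂ : ContDiff ℝ m w₂) (hζ : ContDiff ℝ m ζ) :
    ContDiff ℝ m fun x => _root_.blockFun δ (z x) (w₁ x) (w₂ x) (ζ x) := by
  have hW : ContDiff ℝ m fun x => w₁ x + Complex.I * w₂ x := hw₁.add (contDiff_const.mul hw₂)
  have hf : ContDiff ℝ m fun x => ζ x - conj (z x) * (δ * z x + (w₁ x + Complex.I * w₂ x)) :=
    hζ.sub ((contDiff_conj.comp hz).mul ((contDiff_const.mul hz).add hW))
  have hn := hf.norm_sq ℝ
  have hz' := contDiff_const (c := (1 : ℝ)).add (hz.norm_sq ℝ)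
  exact ((contDiff_const.mul ((hz'.mul (hw₁.complex_im.pow 2)).add
    (hz'.mul (hw₂.complex_im.pow 2)))).add (hf.complex_im.pow 2)).add
    ((((hW.norm_sq ℝ).mul hn).add ((hζ.norm_sq ℝ).mul hn)).add
      (contDiff_const.mul ((hz.norm_sq ℝ).mul hn)))

section NormalForm

variable {k : ℕ}

/-- The index of the coordinate `z`. -/
def zIdx (hk : 1 < k) : Fin (3 * k - 1) := ⟨0, by omega⟩

/-- The index of the coordinate `w_{2i+1}`. -/
def oddIdx (i : Fin (k - 1)) : Fin (3 * k - 1) := ⟨2 * i + 1, by omega⟩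

/-- The index of the coordinate `w_{2i+2}`. -/
def evenIdx (i : Fin (k - 1)) : Fin (3 * k - 1) := ⟨2 * i + 2, by omega⟩

/-- The index of the coordinate `ζ_{i+1}`, for `i + 1 < k`. -/
def zetaIdx (i : Fin (k - 1)) : Fin (3 * k - 1) := ⟨2 * k - 1 + i, by omega⟩

/-- The index of the coordinate `ζ_k`. -/
def lastIdx (hk : 1 < k) : Fin (3 * k - 1) := ⟨3 * k - 2, by omega⟩

/-- The coefficient of `|z|²` in the equation for `ζ_{i+1}`. -/
def blockCoeff (i : Fin (k - 1)) : ℝ := if (i : ℕ) = 0 then 1 else 0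

theorem blockCoeff_nonneg (i : Fin (k - 1)) : 0 ≤ blockCoeff i := by
  rw [blockCoeff]
  split_ifs <;> norm_num

theorem blockCoeff_le_one (i : Fin (k - 1)) : blockCoeff i ≤ 1 := by
  rw [blockCoeff]
  split_ifs <;> norm_num

variable (hk : 1 < k)

theorem eq_zero_of_coordinates {Z : EuclideanSpace ℂ (Fin (3 * k - 1))} (hz : Z (zIdx hk) = 0)
    (hl : Z (lastIdx hk) = 0) (h₁ : ∀ i, Z (oddIdx i) = 0) (h₂ : ∀ i, Z (evenIdx i) = 0)
    (h₃ : ∀ i, Z (zetaIdx i) = 0) : Z = 0 := by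
  ext ⟨j, hj⟩
  rw [PiLp.zero_apply]
  rcases Nat.eq_zero_or_pos j with rfl | hj0
  · exact hz
  rcases eq_or_ne j (3 * k - 2) with rfl | hjl
  · exact hl
  rcases le_or_gt (2 * k - 1) j with hjk | hjk
  · convert h₃ ⟨j - (2 * k - 1), by omega⟩ using 2
    ext
    simp only [zetaIdx]
    omega
  rcases Nat.even_or_odd' j with ⟨m, rfl | rfl⟩
  · convert h₂ ⟨m - 1, by omega⟩ using 2
    ext
    simp only [evenIdx]
    omega
  · exact h₁ ⟨m, by omega⟩

/-- A smooth function vanishing exactly on the normal form, p.s.h. near the origin. -/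
def localFun (Z : EuclideanSpace ℂ (Fin (3 * k - 1))) : ℝ :=
  k * ((1 + ‖Z (zIdx hk)‖ ^ 2) * ‖Z (lastIdx hk) - conj (Z (zIdx hk)) ^ 2‖ ^ 2)
  + ∑ i, blockFun (blockCoeff i) (Z (zIdx hk)) (Z (oddIdx i)) (Z (evenIdx i)) (Z (zetaIdx i))

theorem localFun_nonneg (Z : EuclideanSpace ℂ (Fin (3 * k - 1))) : 0 ≤ localFun hk Z :=
  add_nonneg (by positivity) (Finset.sum_nonneg fun _ _ => blockFun_nonneg _ _ _ _ _)

theorem contDiff_localFun : ContDiff ℝ (⊤ : ℕ∞) (localFun hk) := by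
  have c : ∀ j, ContDiff ℝ (⊤ : ℕ∞) fun Z : EuclideanSpace ℂ (Fin (3 * k - 1)) => Z j :=
    fun j => contDiff_piLp_apply 2
  refine (contDiff_const.mul ((contDiff_const.add ((c _).norm_sq ℝ)).mul
    (((c _).sub ((contDiff_conj.comp (c _)).pow 2)).norm_sq ℝ))).add ?_
  exact ContDiff.sum fun i _ => ContDiff.blockFun _ (c _) (c _) (c _) (c _)

theorem localFun_eq_zero_iff {Z : EuclideanSpace ℂ (Fin (3 * k - 1))} :
    localFun hk Z = 0 ↔ Z (lastIdx hk) = conj (Z (zIdx hk)) ^ 2 ∧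
      ∀ i, (Z (oddIdx i)).im = 0 ∧ (Z (evenIdx i)).im = 0 ∧ Z (zetaIdx i) =
        conj (Z (zIdx hk)) * (blockCoeff i * Z (zIdx hk) +
          (Z (oddIdx i) + Complex.I * Z (evenIdx i))) := by
  have hk' : (k : ℝ) ≠ 0 := by positivity
  have hz : 1 + ‖Z (zIdx hk)‖ ^ 2 ≠ 0 := by positivity
  rw [localFun, add_eq_zero_iff_of_nonneg (by positivity)
    (Finset.sum_nonneg fun _ _ => blockFun_nonneg _ _ _ _ _),
    Finset.sum_eq_zero_iff_of_nonneg fun _ _ => blockFun_nonneg _ _ _ _ _]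
  simp [hk', hz, blockFun_eq_zero_iff, sub_eq_zero]

theorem ofReal_re_of_im_eq_zero {w : ℂ} (h : w.im = 0) : (w.re : ℂ) = w :=
  Complex.ext (by simp) (by simp [h])

theorem setOf_localFun_eq_zero : {Z | localFun hk Z = 0} = bcForm k hk := by
  ext Z
  rw [Set.mem_ofPred_eq, localFun_eq_zero_iff, bcForm, Set.mem_ofPred_eq]
  constructor
  · rintro ⟨hl, h⟩
    have hv : ∀ τ : ℕ, ∀ _h1 : 1 ≤ τ, ∀ _h2 : τ ≤ 2 * k - 2, (Z ⟨τ, by omega⟩).im = 0 := by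
      intro τ h1 h2
      rcases Nat.even_or_odd' τ with ⟨m, rfl | rfl⟩
      · convert (h ⟨m - 1, by omega⟩).2.1 using 3
        ext
        simp only [evenIdx]
        omega
      · exact (h ⟨m, by omega⟩).1
    refine ⟨hv, ?_, ?_, hl⟩
    · rw [ofReal_re_of_im_eq_zero (hv 1 (by omega) (by omega)),
        ofReal_re_of_im_eq_zero (hv 2 (by omega) (by omega)), Complex.normSq_eq_conj_mul_self,
        ← mul_add]
      simpa [blockCoeff, zetaIdx, zIdx, oddIdx, evenIdx] using (h ⟨0, by omega⟩).2.2
    · intro σ h1 h2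
      rw [ofReal_re_of_im_eq_zero (hv (2 * σ - 1) (by omega) (by omega)),
        ofReal_re_of_im_eq_zero (hv (2 * σ) (by omega) (by omega))]
      obtain ⟨m, rfl⟩ : ∃ m, σ = m + 1 := ⟨σ - 1, by omega⟩
      have hm := (h ⟨m, by omega⟩).2.2
      have hm0 : m ≠ 0 := by omega
      simp only [blockCoeff, zetaIdx, zIdx, oddIdx, evenIdx, hm0, if_false, Complex.ofReal_zero,
        zero_mul, zero_add] at hm
      convert hm using 2
      · congr 1
        omega
      · rfl
  · rintro ⟨hv, h₁, hσ, hl⟩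
    refine ⟨hl, fun i => ?_⟩
    have v₁ : (Z (oddIdx i)).im = 0 := hv (2 * i + 1) (by omega) (by omega)
    have v₂ : (Z (evenIdx i)).im = 0 := hv (2 * i + 2) (by omega) (by omega)
    refine ⟨v₁, v₂, ?_⟩
    rw [← ofReal_re_of_im_eq_zero v₁, ← ofReal_re_of_im_eq_zero v₂]
    obtain ⟨i, hi⟩ := i
    rcases Nat.eq_zero_or_pos i with rfl | hi0
    · rw [Complex.normSq_eq_conj_mul_self, ← mul_add] at h₁
      simpa [blockCoeff, zetaIdx, zIdx, oddIdx, evenIdx] using h₁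
    · have h := hσ (i + 1) (by omega) (by omega)
      simp only [blockCoeff, zetaIdx, zIdx, oddIdx, evenIdx, hi0.ne', if_false,
        Complex.ofReal_zero, zero_mul, zero_add]
      convert h using 2
      · congr 1
        omega
      · rfl

/-- The coefficient of `|x|²` contributed by the `i`-th block to the bound on the Levi form. -/
def blockWeight (Z : EuclideanSpace ℂ (Fin (3 * k - 1))) (i : Fin (k - 1)) : ℝ :=
  ‖Z (zetaIdx i) - conj (Z (zIdx hk)) * (blockCoeff i * Z (zIdx hk) +
      (Z (oddIdx i) + Complex.I * Z (evenIdx i)))‖ ^ 2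
    + ‖Z (oddIdx i) + Complex.I * Z (evenIdx i)‖ ^ 4 / 8
    + (Z (oddIdx i)).im ^ 2 + (Z (evenIdx i)).im ^ 2

theorem blockWeight_nonneg (Z : EuclideanSpace ℂ (Fin (3 * k - 1))) (i : Fin (k - 1)) :
    0 ≤ blockWeight hk Z i := by
  rw [blockWeight]
  positivity

theorem eq_zero_of_blockWeight {Z : EuclideanSpace ℂ (Fin (3 * k - 1))} {i : Fin (k - 1)}
    (hz : Z (zIdx hk) = 0) (h : blockWeight hk Z i = 0) :
    Z (oddIdx i) = 0 ∧ Z (evenIdx i) = 0 ∧ Z (zetaIdx i) = 0 := by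
  rw [blockWeight, hz, map_zero, zero_mul, sub_zero] at h
  have p₁ : 0 ≤ ‖Z (zetaIdx i)‖ ^ 2 := by positivity
  have p₂ : 0 ≤ ‖Z (oddIdx i) + Complex.I * Z (evenIdx i)‖ ^ 4 := by positivity
  have p₃ := sq_nonneg (Z (oddIdx i)).im
  have p₄ := sq_nonneg (Z (evenIdx i)).im
  have h₁ : Z (zetaIdx i) = 0 := by
    simpa using (show ‖Z (zetaIdx i)‖ ^ 2 = 0 by linarith)
  have h₂ : Z (oddIdx i) + Complex.I * Z (evenIdx i) = 0 := by
    simpa using (show ‖Z (oddIdx i) + Complex.I * Z (evenIdx i)‖ ^ 4 = 0 by linarith)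
  have h₃ : (Z (oddIdx i)).im = 0 := by
    simpa using (show (Z (oddIdx i)).im ^ 2 = 0 by linarith)
  have h₄ : (Z (evenIdx i)).im = 0 := by
    simpa using (show (Z (evenIdx i)).im ^ 2 = 0 by linarith)
  have hre := congrArg Complex.re h₂
  have him := congrArg Complex.im h₂
  simp only [Complex.add_re, Complex.add_im, Complex.mul_re, Complex.mul_im, Complex.I_re,
    Complex.I_im, Complex.zero_re, Complex.zero_im, zero_mul, one_mul, zero_add, h₃, h₄,
    sub_zero, add_zero] at hre him
  exact ⟨Complex.ext hre h₃, Complex.ext him h₄, h₁⟩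

theorem sliceLaplacian_localFun_ge {p : EuclideanSpace ℂ (Fin (3 * k - 1))}
    (hp : ‖p‖ ≤ 1 / 256) (v : EuclideanSpace ℂ (Fin (3 * k - 1))) :
    4 * (‖v (lastIdx hk)‖ ^ 2 / 2
      + (‖p (zIdx hk)‖ ^ 2 + ‖p (lastIdx hk) - conj (p (zIdx hk)) ^ 2‖ ^ 2 / 2)
        * ‖v (zIdx hk)‖ ^ 2
      + ∑ i, (blockWeight hk p i * ‖v (zIdx hk)‖ ^ 2
        + (‖v (oddIdx i)‖ ^ 2 + ‖v (evenIdx i)‖ ^ 2)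
        + ‖v (zetaIdx i) - conj (p (zIdx hk)) * (v (oddIdx i) + Complex.I * v (evenIdx i))
          + conj (p (oddIdx i) + Complex.I * p (evenIdx i)) * v (zIdx hk)‖ ^ 2 / 8)) ≤
      sliceLaplacian (localFun hk) p v := by
  have hc : ∀ j, ‖p j‖ ≤ 1 / 256 := fun j => (PiLp.norm_apply_le p j).trans hp
  obtain ⟨L₀, h₀, b₀⟩ := exists_hasLevi_conj_sq (p (lastIdx hk)) (v (zIdx hk)) (v (lastIdx hk))
    (hc (zIdx hk)) (hc (lastIdx hk))
  choose L hL bL using fun i : Fin (k - 1) =>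
    exists_hasLevi_blockFun (blockCoeff_nonneg i) (blockCoeff_le_one i) (v (zIdx hk))
      (v (oddIdx i)) (v (evenIdx i)) (v (zetaIdx i)) (hc (zIdx hk)) (hc (oddIdx i))
      (hc (evenIdx i)) (hc (zetaIdx i))
  have h := (h₀.const_mul k).add (HasLevi.sum Finset.univ fun i _ => hL i)
  have e : sliceLaplacian (localFun hk) p v = 4 * (k * L₀ + ∑ i, L i) := by
    rw [sliceLaplacian_eq_laplacian, ← h.2]
    rfl
  have hs := Finset.sum_le_sum fun i (_ : i ∈ Finset.univ) => bL i
  rw [Finset.sum_sub_distrib, Finset.sum_const, Finset.card_univ, Fintype.card_fin, nsmul_eq_mul,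
    Nat.cast_sub hk.le, Nat.cast_one] at hs
  have hk1 : (1 : ℝ) ≤ k := by exact_mod_cast hk.le
  set X := ‖v (zIdx hk)‖ ^ 2
  set g := ‖p (lastIdx hk) - conj (p (zIdx hk)) ^ 2‖ ^ 2
  have q₁ : 0 ≤ ‖p (zIdx hk)‖ ^ 2 * X := by positivity
  have q₂ : 0 ≤ g * X := by positivity
  have q₃ := sq_nonneg ‖v (lastIdx hk)‖
  have b₁ := mul_le_mul_of_nonneg_left b₀ (Nat.cast_nonneg (α := ℝ) k)
  have b₂ := mul_le_mul_of_nonneg_right hk1 q₁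
  have b₃ := mul_le_mul_of_nonneg_right hk1 q₂
  have b₄ := mul_le_mul_of_nonneg_right hk1 q₃
  rw [e]
  simp only [blockWeight]
  linarith

theorem strictPshAt_localFun {p : EuclideanSpace ℂ (Fin (3 * k - 1))} (hp : ‖p‖ ≤ 1 / 256)
    (hp₀ : p ≠ 0) : StrictPshAt (localFun hk) p := by
  intro v hv
  refine lt_of_lt_of_le ?_ (sliceLaplacian_localFun_ge hk hp v)
  by_contra! hle
  have nw := blockWeight_nonneg hk p
  have q₁ : 0 ≤ ‖p (zIdx hk)‖ ^ 2 * ‖v (zIdx hk)‖ ^ 2 := by positivity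
  have q₂ : 0 ≤ ‖p (lastIdx hk) - conj (p (zIdx hk)) ^ 2‖ ^ 2 * ‖v (zIdx hk)‖ ^ 2 := by
    positivity
  have q₃ := sq_nonneg ‖v (lastIdx hk)‖
  set T : Fin (k - 1) → ℝ := fun i => blockWeight hk p i * ‖v (zIdx hk)‖ ^ 2
        + (‖v (oddIdx i)‖ ^ 2 + ‖v (evenIdx i)‖ ^ 2)
        + ‖v (zetaIdx i) - conj (p (zIdx hk)) * (v (oddIdx i) + Complex.I * v (evenIdx i))
          + conj (p (oddIdx i) + Complex.I * p (evenIdx i)) * v (zIdx hk)‖ ^ 2 / 8 with hT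
  have nT : ∀ i ∈ Finset.univ, 0 ≤ T i := fun i _ => by
    have := nw i
    positivity
  have sT := Finset.sum_nonneg nT
  have zT : ∀ i, T i = 0 := fun i =>
    (Finset.sum_eq_zero_iff_of_nonneg nT).1 (by linarith) i (Finset.mem_univ i)
  have bT : ∀ i, blockWeight hk p i * ‖v (zIdx hk)‖ ^ 2 = 0 ∧ v (oddIdx i) = 0 ∧
      v (evenIdx i) = 0 ∧
      v (zetaIdx i) - conj (p (zIdx hk)) * (v (oddIdx i) + Complex.I * v (evenIdx i))
        + conj (p (oddIdx i) + Complex.I * p (evenIdx i)) * v (zIdx hk) = 0 := by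
    intro i
    have h := zT i
    have r₁ := mul_nonneg (nw i) (sq_nonneg ‖v (zIdx hk)‖)
    have r₂ := sq_nonneg ‖v (oddIdx i)‖
    have r₃ := sq_nonneg ‖v (evenIdx i)‖
    have r₄ := sq_nonneg ‖v (zetaIdx i)
      - conj (p (zIdx hk)) * (v (oddIdx i) + Complex.I * v (evenIdx i))
      + conj (p (oddIdx i) + Complex.I * p (evenIdx i)) * v (zIdx hk)‖
    simp only [hT] at h
    refine ⟨by linarith, ?_, ?_, ?_⟩ <;>
    · rw [← norm_eq_zero, ← pow_eq_zero_iff two_ne_zero]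
      linarith
  have hl : v (lastIdx hk) = 0 := by
    rw [← norm_eq_zero, ← pow_eq_zero_iff two_ne_zero]
    linarith
  have hx : v (zIdx hk) = 0 := by
    by_contra hx
    have hX : ‖v (zIdx hk)‖ ^ 2 ≠ 0 := by simpa using hx
    have hz : p (zIdx hk) = 0 := by
      rw [← norm_eq_zero, ← pow_eq_zero_iff two_ne_zero]
      exact (mul_eq_zero.1 (show _ = (0 : ℝ) by linarith)).resolve_right hX
    have hpl : p (lastIdx hk) - conj (p (zIdx hk)) ^ 2 = 0 := by
      rw [← norm_eq_zero, ← pow_eq_zero_iff two_ne_zero]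
      exact (mul_eq_zero.1 (show _ = (0 : ℝ) by linarith)).resolve_right hX
    have hb := fun i => eq_zero_of_blockWeight hk hz ((mul_eq_zero.1 (bT i).1).resolve_right hX)
    exact hp₀ (eq_zero_of_coordinates hk hz (by simpa [hz] using hpl) (fun i => (hb i).1)
      (fun i => (hb i).2.1) fun i => (hb i).2.2)
  refine hv (eq_zero_of_coordinates hk hx hl (fun i => (bT i).2.1) (fun i => (bT i).2.2.1)
    fun i => ?_)
  simpa [hx, (bT i).2.1, (bT i).2.2.1] using (bT i).2.2.2

theorem sliceLaplacian_localFun_nonneg {p : EuclideanSpace ℂ (Fin (3 * k - 1))}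
    (hp : ‖p‖ ≤ 1 / 256) (v : EuclideanSpace ℂ (Fin (3 * k - 1))) :
    0 ≤ sliceLaplacian (localFun hk) p v := by
  have nw := blockWeight_nonneg hk p
  refine le_trans ?_ (sliceLaplacian_localFun_ge hk hp v)
  have : 0 ≤ ∑ i, (blockWeight hk p i * ‖v (zIdx hk)‖ ^ 2
        + (‖v (oddIdx i)‖ ^ 2 + ‖v (evenIdx i)‖ ^ 2)
        + ‖v (zetaIdx i) - conj (p (zIdx hk)) * (v (oddIdx i) + Complex.I * v (evenIdx i))
          + conj (p (oddIdx i) + Complex.I * p (evenIdx i)) * v (zIdx hk)‖ ^ 2 / 8) :=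
    Finset.sum_nonneg fun i _ => by
      have := nw i
      positivity
  positivity

end NormalForm

/-- **Proposition 5.1.** For `k > 1` and all small enough `r > 0`, there is a smooth
p.s.h. function `ψ : ℂ^{3k-1} → ℝ` with `{ψ = 0} = 𝓜_k ∩ B̄_O(r)`, `ψ > 0` off
`𝓜_k ∩ B̄_O(r)`, and `ψ` strictly p.s.h. on `ℂ^{3k-1} \ {O}`. -/
theorem psh_function_vanishing_on_bcForm
    (k : ℕ) (hk : 1 < k) :
    ∃ r₀ : ℝ, 0 < r₀ ∧ ∀ r : ℝ, 0 < r → r ≤ r₀ →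
      ∃ ψ : EuclideanSpace ℂ (Fin (3*k-1)) → ℝ,
        ContDiff ℝ (⊤ : ℕ∞) ψ ∧ PshOn ψ Set.univ ∧
        {z | ψ z = 0} = bcForm k hk ∩ Metric.closedBall 0 r ∧
        (∀ z ∉ bcForm k hk ∩
          Metric.closedBall (0 : EuclideanSpace ℂ (Fin (3*k-1))) r, 0 < ψ z) ∧
        (∀ z : EuclideanSpace ℂ (Fin (3*k-1)), z ≠ 0 → StrictPshAt ψ z) := by
  refine ⟨1 / 512, by norm_num, fun r hr hr₀ => ?_⟩
  rw [← setOf_localFun_eq_zero hk]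
  exact exists_psh_extension (contDiff_localFun hk) (localFun_nonneg hk) hr
    (hr₀.trans_lt (by norm_num : (1 / 512 : ℝ) < 1 / 256))
    (fun p hp v => sliceLaplacian_localFun_nonneg hk hp v)
    fun p hp hp₀ => strictPshAt_localFun hk hp hp₀
end
end
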